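/- arXiv:1310.1645 — 2 statements merged into one kernel-verified Lean document; each statement's English description precedes it below -/
import Mathlib

section
/- Let q be a prime power, k = F_q(t), m a prime divisor of q−1, and S = {D_1,...,D_l} nonzero polynomials in F_q[t] such that K = k(D_1^{1/m},...,D_l^{1/m}) is a geometric extension of k. Let γ_S be the cardinality of {(a_1,...,a_l) ∈ {0,...,m−1}^l : D_1^{a_1}···D_l^{a_l} is an m-th power in F_q[t]}. Let M be the set of monic irreducible polynomials P ∈ F_q[t] with (D_1/P)_m = ··· = (D_l/P)_m = 1. Then the relative density of M exists and equals γ_S / m^l; that is, the limit as N → ∞ of #{P ∈ M : deg P = N} / π(N) equals γ_S/m^l. -/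
open Polynomial Filter

namespace KummerDensity

section PowerSums

lemma exists_le_norm_pow_le_re (s : Multiset ℂ) (K : ℕ) :
    ∃ k, K ≤ k ∧ ∀ β ∈ s, ‖β‖ ^ k / 2 ≤ (β ^ k).re := by
  have hcl := mapClusterPt_one_atTop_pow (fun β : ℂ => Circle.exp β.arg)
  have hopen : IsOpen {y : ℂ → Circle | ∀ β ∈ s.toFinset, 1 / 2 < (y β : ℂ).re} := by
    simp only [Set.ofPred_forall]
    refine isOpen_biInter_finset fun β _ => ?_
    exact isOpen_lt continuous_const
      (Complex.continuous_re.comp (continuous_subtype_val.comp (continuous_apply β)))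
  have hmem : {y : ℂ → Circle | ∀ β ∈ s.toFinset, 1 / 2 < (y β : ℂ).re} ∈ nhds 1 :=
    hopen.mem_nhds (by intro β _; norm_num)
  obtain ⟨k, hk, hy⟩ := ((hcl.frequently hmem).and_eventually (eventually_ge_atTop K)).exists
  refine ⟨k, hy, fun β hβ => ?_⟩
  have h1 := hk β (Multiset.mem_toFinset.2 hβ)
  have h2 : β ^ k = ((‖β‖ ^ k : ℝ) : ℂ) * ((Circle.exp β.arg ^ k : Circle) : ℂ) := by
    conv_lhs => rw [← Complex.norm_mul_exp_arg_mul_I β]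
    rw [mul_pow]
    simp
  rw [h2, Complex.re_ofReal_mul]
  have h3 : 1 / 2 < ((Circle.exp β.arg ^ k : Circle) : ℂ).re := h1
  nlinarith [pow_nonneg (norm_nonneg β) k]

lemma re_multiset_sum (s : Multiset ℂ) : s.sum.re = (s.map Complex.re).sum :=
  map_multiset_sum Complex.reAddGroupHom s

lemma norm_lt_of_powerSum (s : Multiset ℂ) (q : ℝ) (hq : 0 < q)
    (hle : ∀ k, 1 ≤ k → ‖(s.map (· ^ k)).sum‖ ≤ q ^ k)
    (hne : ∀ w : ℂ, ‖w‖ = 1 → ∃ k, 1 ≤ k ∧ w ^ k * (s.map (· ^ k)).sum ≠ (q : ℂ) ^ k) :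
    ∀ α ∈ s, ‖α‖ < q := by
  have hle' : ∀ α ∈ s, ‖α‖ ≤ q := by
    intro α hα
    by_contra! hlt
    have hr : 1 < ‖α‖ / q := (one_lt_div hq).2 hlt
    obtain ⟨K, hK⟩ := pow_unbounded_of_one_lt 2 hr
    obtain ⟨k, hk, hs⟩ := exists_le_norm_pow_le_re s (K + 1)
    have h1 : (α ^ k).re ≤ (s.map (fun β => (β ^ k).re)).sum := by
      refine Multiset.single_le_sum ?_ _ (Multiset.mem_map_of_mem _ hα)
      intro x hx
      obtain ⟨β, hβ, rfl⟩ := Multiset.mem_map.1 hx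
      exact le_trans (by positivity) (hs β hβ)
    have h2 : (s.map (fun β => (β ^ k).re)).sum ≤ q ^ k := by
      have := (Complex.re_le_norm _).trans (hle k (by omega))
      rwa [re_multiset_sum, Multiset.map_map] at this
    have h3 : 2 < (‖α‖ / q) ^ k := hK.trans_le (pow_le_pow_right₀ hr.le (by omega))
    rw [div_pow, lt_div_iff₀ (by positivity)] at h3
    linarith [hs α hα]
  intro α hα
  refine lt_of_le_of_ne (hle' α hα) fun heq => ?_
  have hα0 : α ≠ 0 := norm_pos_iff.1 (heq ▸ hq)
  set w : ℂ := q / α with hw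
  have hwn : ‖w‖ = 1 := by simp [hw, heq, abs_of_pos hq, hq.ne']
  obtain ⟨t, rfl⟩ := Multiset.exists_cons_of_mem hα
  have hsplit : ∀ k, w ^ k * ((α ::ₘ t).map (· ^ k)).sum
      = (q : ℂ) ^ k + ((t.map (w * ·)).map (· ^ k)).sum := by
    intro k
    simp only [Multiset.map_cons, Multiset.sum_cons, mul_add, Multiset.map_map,
      Function.comp_def, mul_pow]
    rw [Multiset.sum_map_mul_left]
    congr 1
    rw [hw, ← mul_pow, div_mul_cancel₀ _ hα0]
  have hre : ∀ k, 1 ≤ k → (((t.map (w * ·)).map (· ^ k)).sum).re ≤ 0 := by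
    intro k hk
    have h1 : (w ^ k * ((α ::ₘ t).map (· ^ k)).sum).re ≤ q ^ k := by
      refine (Complex.re_le_norm _).trans ?_
      rw [norm_mul, norm_pow, hwn, one_pow, one_mul]
      exact hle k hk
    rw [hsplit, Complex.add_re, ← Complex.ofReal_pow, Complex.ofReal_re] at h1
    linarith
  have hzero : ∀ β ∈ t.map (w * ·), β = 0 := by
    intro β hβ
    obtain ⟨k, hk, hs⟩ := exists_le_norm_pow_le_re (t.map (w * ·)) 1
    have h1 : (β ^ k).re ≤ ((t.map (w * ·)).map (fun β => (β ^ k).re)).sum := by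
      refine Multiset.single_le_sum ?_ _ (Multiset.mem_map_of_mem _ hβ)
      intro x hx
      obtain ⟨γ, hγ, rfl⟩ := Multiset.mem_map.1 hx
      exact le_trans (by positivity) (hs γ hγ)
    have h2 := hre k hk
    rw [re_multiset_sum, Multiset.map_map] at h2
    have h3 : ‖β‖ ^ k ≤ 0 := by linarith [hs β hβ, h1.trans h2]
    have h4 : ‖β‖ ^ k = 0 := le_antisymm h3 (by positivity)
    exact norm_eq_zero.1 (pow_eq_zero_iff (by omega) |>.1 h4)
  obtain ⟨k, hk, hkne⟩ := hne w hwn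
  apply hkne
  rw [hsplit, Multiset.sum_eq_zero, add_zero]
  intro x hx
  obtain ⟨β, hβ, rfl⟩ := Multiset.mem_map.1 hx
  rw [hzero β hβ, zero_pow (by omega)]

lemma tendsto_powerSum_div_pow (s : Multiset ℂ) (q : ℝ) (hs : ∀ α ∈ s, ‖α‖ < q) :
    Tendsto (fun k : ℕ => ‖(s.map (· ^ k)).sum‖ / q ^ k) atTop (nhds 0) := by
  have key : Tendsto (fun k : ℕ => (s.map (fun α : ℂ => (α / (q : ℂ)) ^ k)).sum) atTop
      (nhds 0) := by
    induction s using Multiset.induction with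
    | empty => simp
    | cons a s ih =>
      simp only [Multiset.map_cons, Multiset.sum_cons]
      have ha := hs a (Multiset.mem_cons_self a s)
      have hq : 0 < q := (norm_nonneg a).trans_lt ha
      rw [← add_zero (0 : ℂ)]
      refine Tendsto.add (tendsto_pow_atTop_nhds_zero_of_norm_lt_one ?_)
        (ih fun α hα => hs α (Multiset.mem_cons_of_mem hα))
      rw [norm_div, Complex.norm_real, Real.norm_of_nonneg hq.le]
      exact (div_lt_one hq).2 ha
  rcases s.empty_or_exists_mem with rfl | ⟨a, ha⟩
  · simp
  have hq : 0 < q := (norm_nonneg a).trans_lt (hs a ha)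
  refine (tendsto_zero_iff_norm_tendsto_zero.1 key).congr fun k => ?_
  simp only [div_pow, Multiset.sum_map_div]
  simp [abs_of_pos hq]

end PowerSums

section LogDeriv

lemma exists_eq_prod_one_sub (L : ℂ[X]) (h0 : L.coeff 0 = 1) :
    ∃ s : Multiset ℂ, L = (s.map fun α => 1 - C α * X).prod := by
  refine ⟨L.roots.map (·⁻¹), ?_⟩
  have hsp := (IsAlgClosed.splits L).eq_prod_roots
  have hr : ∀ r ∈ L.roots, r ≠ 0 := by
    rintro r hr rfl
    have := (mem_roots'.1 hr).2
    rw [IsRoot, ← coeff_zero_eq_eval_zero, h0] at this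
    exact one_ne_zero this
  have h1 : (L.roots.map fun r => X - C r) =
      L.roots.map fun r => C (-r) * (1 - C r⁻¹ * X) := by
    refine Multiset.map_congr rfl fun r hr' => ?_
    rw [mul_sub, ← mul_assoc, ← C_mul, neg_mul, mul_inv_cancel₀ (hr r hr')]
    simp; ring
  rw [h1, Multiset.prod_map_mul, ← mul_assoc] at hsp
  rw [Multiset.map_map]
  set M := (L.roots.map fun r => 1 - C r⁻¹ * X).prod with hM
  have hM0 : M.eval 0 = 1 := by
    rw [hM, eval_multiset_prod, Multiset.map_map]
    refine Multiset.prod_eq_one ?_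
    simp [Multiset.mem_replicate]
  have hc : (L.roots.map fun r => C (-r)).prod = C (L.roots.map fun r => -r).prod := by
    rw [map_multiset_prod, Multiset.map_map]; rfl
  rw [hc, ← C_mul] at hsp
  have hcoef := congrArg (eval 0) hsp
  rw [eval_mul, eval_C, hM0, ← coeff_zero_eq_eval_zero, h0, mul_one] at hcoef
  rw [← hcoef, C_1, one_mul] at hsp
  simpa [Function.comp_def] using hsp

lemma X_mul_derivative_prod (s : Multiset ℂ) :
    ((X * derivative (s.map fun α => 1 - C α * X).prod : ℂ[X]) : PowerSeries ℂ) =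
      PowerSeries.mk (fun k => if k = 0 then 0 else -(s.map (· ^ k)).sum) *
        ((s.map fun α => 1 - C α * X).prod : ℂ[X]) := by
  induction s using Multiset.induction with
  | empty =>
    have : (PowerSeries.mk fun k : ℕ => if k = 0 then (0 : ℂ) else
        -((0 : Multiset ℂ).map (· ^ k)).sum) = 0 := by
      ext k; simp
    rw [this]; simp
  | cons a s ih =>
    set M := (s.map fun α => 1 - C α * X).prod
    have hP : PowerSeries.mk (fun k => if k = 0 then 0 else -((a ::ₘ s).map (· ^ k)).sum) =
        PowerSeries.mk (fun k => if k = 0 then 0 else -a ^ k) +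
        PowerSeries.mk (fun k => if k = 0 then 0 else -(s.map (· ^ k)).sum) := by
      ext k
      by_cases hk : k = 0 <;> simp [hk]; ring
    have ha : PowerSeries.mk (fun k => if k = 0 then 0 else -a ^ k) *
        ((1 - C a * X : ℂ[X]) : PowerSeries ℂ) = ((-(C a * X) : ℂ[X]) : PowerSeries ℂ) := by
      ext k
      have h1 : ((1 - C a * X : ℂ[X]) : PowerSeries ℂ) =
          1 - PowerSeries.C a * PowerSeries.X := by simp
      rw [h1, mul_sub, mul_one, ← mul_assoc, map_sub, Polynomial.coeff_coe]
      rcases k with _ | k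
      · simp
      · rw [PowerSeries.coeff_succ_mul_X, PowerSeries.coeff_mul_C]
        rcases k with _ | k
        · simp
        · simp; ring
    rw [Multiset.map_cons, Multiset.prod_cons, hP, derivative_mul]
    have hd : derivative (1 - C a * X : ℂ[X]) = - C a := by simp
    rw [hd, Polynomial.coe_mul (1 - C a * X)]
    have : X * (-C a * M + (1 - C a * X) * derivative M)
        = -(C a * X) * M + (1 - C a * X) * (X * derivative M) := by ring
    rw [this, Polynomial.coe_add, Polynomial.coe_mul, Polynomial.coe_mul (1 - C a * X), ih, ← ha]
    ring

lemma exists_eq_neg_powerSum (S c : ℕ → ℂ) (n₀ : ℕ) (hS0 : S 0 = 1) (hS : ∀ n, n₀ ≤ n → S n = 0)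
    (hrec : ∀ n, n * S n = ∑ k ∈ Finset.Icc 1 n, c k * S (n - k)) :
    ∃ s : Multiset ℂ, ∀ k, 1 ≤ k → c k = -(s.map (· ^ k)).sum := by
  set L : ℂ[X] := ∑ n ∈ Finset.range n₀, monomial n (S n) with hL
  have hcoeff : ∀ n, L.coeff n = S n := by
    intro n
    simp only [hL, finsetSum_coeff, coeff_monomial]
    rw [Finset.sum_ite_eq']
    split_ifs with h
    · rfl
    · exact (hS n (by simpa using h)).symm
  obtain ⟨s, hs⟩ := exists_eq_prod_one_sub L (by rw [hcoeff, hS0])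
  refine ⟨s, fun k hk => ?_⟩
  have h1 := X_mul_derivative_prod s
  rw [← hs] at h1
  have h2 : ((X * derivative L : ℂ[X]) : PowerSeries ℂ) =
      PowerSeries.mk (fun k => if k = 0 then 0 else c k) * (L : PowerSeries ℂ) := by
    ext n
    rw [Polynomial.coeff_coe, PowerSeries.coeff_mul,
      Finset.Nat.sum_antidiagonal_eq_sum_range_succ_mk, Finset.sum_range_succ']
    simp only [PowerSeries.coeff_mk, Polynomial.coeff_coe, hcoeff, if_true, zero_mul, add_zero]
    have h3 : (X * derivative L).coeff n = n * S n := by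
      rcases n with _ | n
      · simp
      · rw [coeff_X_mul, coeff_derivative, hcoeff]; push_cast; ring
    rw [h3, hrec, Finset.range_eq_Ico,
      Finset.sum_Ico_add' (fun k => (if k = 0 then 0 else c k) * S (n - k)) 0 n 1]
    refine Finset.sum_congr (by ext; simp) fun k hk => ?_
    rw [if_neg (by simp at hk; omega)]
  have hL0 : (L : PowerSeries ℂ) ≠ 0 := by
    intro h
    have := congrArg (PowerSeries.coeff 0) h
    rw [Polynomial.coeff_coe, hcoeff, hS0] at this
    simp at this
  have h3 := mul_right_cancel₀ hL0 (h2.symm.trans h1)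
  have h4 := congrArg (PowerSeries.coeff k) h3
  simpa [show k ≠ 0 by omega] using h4

end LogDeriv

section Counting

variable {F : Type*} [Field F] [Fintype F]

/-- The monic polynomials of degree `n`. -/
noncomputable def monics (F : Type*) [Field F] [Fintype F] (n : ℕ) : Finset F[X] :=
  Finset.univ.map ((((monicEquivDegreeLT n).trans
    (degreeLTEquiv F n).toEquiv).symm.toEmbedding).trans (Function.Embedding.subtype _))

lemma mem_monics {n : ℕ} {g : F[X]} : g ∈ monics F n ↔ g.Monic ∧ g.natDegree = n := by
  rw [monics, Finset.mem_map]
  constructor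
  · rintro ⟨v, -, rfl⟩
    exact (((monicEquivDegreeLT n).trans (degreeLTEquiv F n).toEquiv).symm v).2
  · intro hg
    exact ⟨((monicEquivDegreeLT n).trans (degreeLTEquiv F n).toEquiv) ⟨g, hg⟩,
      Finset.mem_univ _, by simp⟩

lemma card_monics (n : ℕ) : (monics F n).card = Fintype.card F ^ n := by
  simp [monics]

open Classical in
/-- The monic irreducible polynomials of degree `n`. -/
noncomputable def primes (F : Type*) [Field F] [Fintype F] (n : ℕ) : Finset F[X] :=
  (monics F n).filter Irreducible

lemma mem_primes {n : ℕ} {P : F[X]} :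
    P ∈ primes F n ↔ P.Monic ∧ P.natDegree = n ∧ Irreducible P := by
  simp [primes, mem_monics, and_assoc]

open Classical in
/-- The monic irreducible polynomials of degree dividing `k`. -/
noncomputable def primesDvd (F : Type*) [Field F] [Fintype F] (k : ℕ) : Finset F[X] :=
  k.divisors.biUnion (primes F)

lemma mem_primesDvd {k : ℕ} (hk : k ≠ 0) {P : F[X]} :
    P ∈ primesDvd F k ↔ P.Monic ∧ Irreducible P ∧ P.natDegree ∣ k := by
  simp only [primesDvd, Finset.mem_biUnion, Nat.mem_divisors, mem_primes]
  constructor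
  · rintro ⟨d, ⟨h, -⟩, h1, rfl, h2⟩
    exact ⟨h1, h2, h⟩
  · rintro ⟨h1, h2, h⟩
    exact ⟨_, ⟨h, hk⟩, h1, rfl, h2⟩

/-- The sum of a character over monic polynomials of degree `n`: a coefficient of its
`L`-function. -/
noncomputable def monicSum (χ : F[X] →* ℂ) (n : ℕ) : ℂ := ∑ g ∈ monics F n, χ g

/-- The sum of `Λ(g) χ(g)` over monic polynomials `g` of degree `k`. -/
noncomputable def mangoldtSum (χ : F[X] →* ℂ) (k : ℕ) : ℂ :=
  ∑ P ∈ primesDvd F k, (P.natDegree : ℂ) * χ P ^ (k / P.natDegree)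

lemma monicSum_zero (χ : F[X] →* ℂ) : monicSum χ 0 = 1 := by
  have : monics F 0 = {1} := by
    ext g
    simp only [mem_monics, Finset.mem_singleton]
    constructor
    · rintro ⟨h1, h2⟩
      exact h1.natDegree_eq_zero.1 h2
    · rintro rfl
      simp
  simp [monicSum, this]

open Classical in
lemma sum_monics_dvd (χ : F[X] →* ℂ) {Q : F[X]} (hQ : Q.Monic) {n : ℕ} (h : Q.natDegree ≤ n) :
    ∑ g ∈ monics F n, (if Q ∣ g then χ g else 0) = χ Q * monicSum χ (n - Q.natDegree) := by
  rw [← Finset.sum_filter, monicSum, Finset.mul_sum]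
  symm
  refine Finset.sum_bij (fun g _ => Q * g) ?_ ?_ ?_ ?_
  · intro g hg
    rw [mem_monics] at hg
    rw [Finset.mem_filter, mem_monics]
    refine ⟨⟨hQ.mul hg.1, ?_⟩, dvd_mul_right _ _⟩
    rw [hQ.natDegree_mul hg.1]; omega
  · intro a _ b _ hab
    exact mul_left_cancel₀ hQ.ne_zero hab
  · intro g hg
    rw [Finset.mem_filter, mem_monics] at hg
    obtain ⟨⟨h1, h2⟩, c, rfl⟩ := hg
    have hc : c.Monic := hQ.of_mul_monic_left h1
    refine ⟨c, ?_, rfl⟩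
    rw [mem_monics]
    rw [hQ.natDegree_mul hc] at h2
    exact ⟨hc, by omega⟩
  · intro g _
    rw [map_mul]

open Classical in
lemma sum_natDegree_of_pow_dvd {g : F[X]} (hg : g.Monic) :
    ∑ k ∈ Finset.Icc 1 g.natDegree, ∑ P ∈ primesDvd F k,
      (if P ^ (k / P.natDegree) ∣ g then P.natDegree else 0) = g.natDegree := by
  set s := UniqueFactorizationMonoid.normalizedFactors g with hs
  have hmonic : ∀ P ∈ s, P.Monic ∧ Irreducible P := by
    intro P hP
    refine ⟨?_, UniqueFactorizationMonoid.irreducible_of_normalized_factor P hP⟩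
    have h0 := (UniqueFactorizationMonoid.irreducible_of_normalized_factor P hP).ne_zero
    rw [← UniqueFactorizationMonoid.normalize_normalized_factor P hP]
    exact monic_normalize h0
  have hprod : s.prod = g := by
    rw [hs, UniqueFactorizationMonoid.prod_normalizedFactors_eq hg.ne_zero, hg.normalize_eq_self]
  have hdeg : g.natDegree = ∑ P ∈ s.toFinset, ∑ j ∈ Finset.Icc 1 (s.count P), P.natDegree := by
    conv_lhs => rw [← hprod]
    rw [natDegree_multiset_prod_of_monic _ fun P hP => (hmonic P hP).1]
    rw [Finset.sum_multiset_map_count]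
    simp
  have hdvd : ∀ P : F[X], P.Monic → Irreducible P → ∀ j, P ^ j ∣ g ↔ j ≤ s.count P := by
    intro P hP hP' j
    rw [pow_dvd_iff_le_emultiplicity,
      UniqueFactorizationMonoid.emultiplicity_eq_count_normalizedFactors hP' hg.ne_zero,
      hP.normalize_eq_self]
    simp [hs]
  conv_rhs => rw [hdeg]
  rw [Finset.sum_sigma', Finset.sum_sigma', ← Finset.sum_filter]
  refine Finset.sum_bij' (fun x _ => ⟨x.2, x.1 / x.2.natDegree⟩)
    (fun y _ => ⟨y.2 * y.1.natDegree, y.1⟩) ?_ ?_ ?_ ?_ ?_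
  · rintro ⟨k, P⟩ hx
    simp only [Finset.mem_filter, Finset.mem_sigma, Finset.mem_Icc] at hx ⊢
    obtain ⟨⟨⟨hk1, hk2⟩, hP⟩, hd⟩ := hx
    rw [mem_primesDvd (by omega)] at hP
    obtain ⟨hP1, hP2, hP3⟩ := hP
    have hj : 1 ≤ k / P.natDegree := Nat.div_pos (Nat.le_of_dvd (by omega) hP3) hP2.natDegree_pos
    rw [hdvd P hP1 hP2] at hd
    exact ⟨Multiset.mem_toFinset.2 (Multiset.count_pos.1 (by omega)), hj, hd⟩
  · rintro ⟨P, j⟩ hx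
    simp only [Finset.mem_filter, Finset.mem_sigma, Finset.mem_Icc, Multiset.mem_toFinset] at hx ⊢
    obtain ⟨hP, hj1, hj2⟩ := hx
    obtain ⟨hP1, hP2⟩ := hmonic P hP
    have hpos := hP2.natDegree_pos
    have hd := (hdvd P hP1 hP2 j).2 hj2
    have hk : 1 ≤ j * P.natDegree := Nat.mul_pos hj1 hpos
    refine ⟨⟨⟨hk, ?_⟩, ?_⟩, ?_⟩
    · have := natDegree_le_of_dvd hd hg.ne_zero
      rwa [natDegree_pow] at this
    · rw [mem_primesDvd (by omega)]
      exact ⟨hP1, hP2, dvd_mul_left _ _⟩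
    · rwa [Nat.mul_div_cancel _ hpos]
  · rintro ⟨k, P⟩ hx
    simp only [Finset.mem_filter, Finset.mem_sigma, Finset.mem_Icc] at hx ⊢
    obtain ⟨⟨⟨hk1, hk2⟩, hP⟩, hd⟩ := hx
    rw [mem_primesDvd (by omega)] at hP
    simp [Nat.div_mul_cancel hP.2.2]
  · rintro ⟨P, j⟩ hx
    simp only [Finset.mem_sigma, Multiset.mem_toFinset] at hx ⊢
    rw [Nat.mul_div_cancel _ (hmonic P hx.1).2.natDegree_pos]
  · rintro ⟨k, P⟩ _
    rfl

lemma natCast_mul_monicSum (χ : F[X] →* ℂ) (n : ℕ) :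
    n * monicSum χ n = ∑ k ∈ Finset.Icc 1 n, mangoldtSum χ k * monicSum χ (n - k) := by
  classical
  have h1 : n * monicSum χ n = ∑ g ∈ monics F n, ∑ k ∈ Finset.Icc 1 n, ∑ P ∈ primesDvd F k,
      (P.natDegree : ℂ) * (if P ^ (k / P.natDegree) ∣ g then χ g else 0) := by
    rw [monicSum, Finset.mul_sum]
    refine Finset.sum_congr rfl fun g hg => ?_
    obtain ⟨hg1, rfl⟩ := mem_monics.1 hg
    conv_lhs => rw [← sum_natDegree_of_pow_dvd hg1]
    push_cast
    simp only [Finset.sum_mul]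
    refine Finset.sum_congr rfl fun k _ => Finset.sum_congr rfl fun P _ => ?_
    split_ifs <;> simp
  rw [h1, Finset.sum_comm]
  refine Finset.sum_congr rfl fun k hk => ?_
  rw [Finset.mem_Icc] at hk
  rw [Finset.sum_comm, mangoldtSum, Finset.sum_mul]
  refine Finset.sum_congr rfl fun P hP => ?_
  rw [mem_primesDvd (by omega)] at hP
  have hd : (P ^ (k / P.natDegree)).natDegree = k := by
    rw [natDegree_pow, Nat.div_mul_cancel hP.2.2]
  rw [← Finset.mul_sum, sum_monics_dvd χ (hP.1.pow _) (by omega), hd, map_pow, mul_assoc]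

lemma mangoldtSum_one {k : ℕ} (hk : 1 ≤ k) :
    mangoldtSum (1 : F[X] →* ℂ) k = (Fintype.card F : ℂ) ^ k := by
  have hS : ∀ n, monicSum (1 : F[X] →* ℂ) n = (Fintype.card F : ℂ) ^ n := by
    intro n
    simp [monicSum, card_monics]
  obtain ⟨n, rfl⟩ : ∃ n, k = n + 1 := ⟨k - 1, by omega⟩
  have h1 := natCast_mul_monicSum (1 : F[X] →* ℂ) (n + 1)
  have h2 := natCast_mul_monicSum (1 : F[X] →* ℂ) n
  rw [Finset.sum_Icc_succ_top (by omega)] at h1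
  simp only [hS, Nat.sub_self, pow_zero, mul_one] at h1 h2
  have h3 : ∑ k ∈ Finset.Icc 1 n,
      mangoldtSum (1 : F[X] →* ℂ) k * (Fintype.card F : ℂ) ^ (n + 1 - k) =
      Fintype.card F * (n * (Fintype.card F : ℂ) ^ n) := by
    rw [h2, Finset.mul_sum]
    refine Finset.sum_congr rfl fun k hk => ?_
    rw [Finset.mem_Icc] at hk
    rw [show n + 1 - k = (n - k) + 1 by omega, pow_succ]; ring
  rw [h3] at h1
  push_cast at h1
  linear_combination -h1

lemma sum_natDegree_primesDvd {k : ℕ} (hk : 1 ≤ k) :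
    ∑ P ∈ primesDvd F k, (P.natDegree : ℝ) = (Fintype.card F : ℝ) ^ k := by
  have := mangoldtSum_one (F := F) hk
  simp only [mangoldtSum, MonoidHom.one_apply, one_pow, mul_one] at this
  exact_mod_cast this

lemma norm_mangoldtSum_le (χ : F[X] →* ℂ) (hχ : ∀ g, ‖χ g‖ ≤ 1) {k : ℕ} (hk : 1 ≤ k) :
    ‖mangoldtSum χ k‖ ≤ (Fintype.card F : ℝ) ^ k := by
  rw [← sum_natDegree_primesDvd hk]
  refine norm_sum_le_of_le _ fun P _ => ?_
  rw [norm_mul, norm_pow, Complex.norm_natCast]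
  exact mul_le_of_le_one_right (by positivity) (pow_le_one₀ (norm_nonneg _) (hχ P))

lemma exists_mangoldtSum_ne (χ : F[X] →* ℂ) (hχ : ∀ g, ‖χ g‖ ≤ 1) (w : ℂ) (hw : ‖w‖ = 1) :
    ∃ k, 1 ≤ k ∧ w ^ k * mangoldtSum χ k ≠ -(Fintype.card F : ℂ) ^ k := by
  by_contra! hcon
  have key : ∀ k, 1 ≤ k → ∀ P ∈ primesDvd F k, w ^ k * χ P ^ (k / P.natDegree) = -1 := by
    intro k hk
    have hre : ∀ P : F[X], (w ^ k * χ P ^ (k / P.natDegree)).re ≥ -1 := by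
      intro P
      have h1 : ‖w ^ k * χ P ^ (k / P.natDegree)‖ ≤ 1 := by
        rw [norm_mul, norm_pow, hw, one_pow, one_mul, norm_pow]
        exact pow_le_one₀ (norm_nonneg _) (hχ P)
      have := (abs_le.1 (Complex.abs_re_le_norm (w ^ k * χ P ^ (k / P.natDegree)))).1
      linarith
    have hsum : ∑ P ∈ primesDvd F k,
        (P.natDegree : ℝ) * (1 + (w ^ k * χ P ^ (k / P.natDegree)).re) = 0 := by
      have h1 := congrArg Complex.re (hcon k hk)
      rw [mangoldtSum, Finset.mul_sum, Complex.re_sum] at h1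
      have h2 : (-(Fintype.card F : ℂ) ^ k).re = -(Fintype.card F : ℝ) ^ k := by
        rw [Complex.neg_re]; norm_cast
      rw [h2, ← sum_natDegree_primesDvd hk] at h1
      simp only [mul_add, mul_one, Finset.sum_add_distrib]
      rw [← neg_eq_iff_add_eq_zero, ← h1]
      refine Finset.sum_congr rfl fun P _ => ?_
      rw [mul_left_comm, ← Complex.ofReal_natCast, Complex.re_ofReal_mul]
    intro P hP
    have h1 := (Finset.sum_eq_zero_iff_of_nonneg (fun P _ =>
      mul_nonneg (Nat.cast_nonneg _) (by linarith [hre P]))).1 hsum P hP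
    rw [mem_primesDvd (by omega)] at hP
    have h2 : (w ^ k * χ P ^ (k / P.natDegree)).re = -1 := by
      have := (mul_eq_zero.1 h1).resolve_left (by exact_mod_cast hP.2.1.natDegree_pos.ne')
      linarith
    have h3 : ‖w ^ k * χ P ^ (k / P.natDegree)‖ ≤ 1 := by
      rw [norm_mul, norm_pow, hw, one_pow, one_mul, norm_pow]
      exact pow_le_one₀ (norm_nonneg _) (hχ P)
    have h4 := Complex.sq_norm_sub_sq_re (w ^ k * χ P ^ (k / P.natDegree))
    refine Complex.ext h2 ?_
    rw [h2] at h4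
    have : (w ^ k * χ P ^ (k / P.natDegree)).im ^ 2 ≤ 0 := by
      rw [← h4]; nlinarith [norm_nonneg (w ^ k * χ P ^ (k / P.natDegree))]
    simpa using pow_eq_zero_iff (two_ne_zero) |>.1 (le_antisymm this (sq_nonneg _))
  have hX : ∀ k, 1 ≤ k → (X : F[X]) ∈ primesDvd F k := fun k hk => by
    rw [mem_primesDvd (by omega)]
    exact ⟨monic_X, irreducible_X, by simp⟩
  have h1 := key 1 le_rfl X (hX 1 le_rfl)
  have h2 := key 2 one_le_two X (hX 2 one_le_two)
  simp only [natDegree_X, Nat.div_one, pow_one] at h1 h2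
  rw [← mul_pow, h1] at h2
  norm_num at h2

end Counting

section Asymptotics

variable {F : Type*} [Field F] [Fintype F]

lemma primes_subset_primesDvd {N : ℕ} (hN : 1 ≤ N) : primes F N ⊆ primesDvd F N := by
  intro P hP
  rw [mem_primes] at hP
  rw [mem_primesDvd (by omega)]
  exact ⟨hP.1, hP.2.2, hP.2.1.dvd⟩

open Classical in
lemma card_primesDvd_sdiff_le {N : ℕ} (hN : 1 ≤ N) :
    ((primesDvd F N \ primes F N).card : ℝ) ≤ (N + 1) * √(Fintype.card F) ^ N := by
  have hsub : primesDvd F N \ primes F N ⊆ (Finset.range (N / 2 + 1)).biUnion (monics F) := by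
    intro P hP
    rw [Finset.mem_sdiff, mem_primesDvd (by omega), mem_primes] at hP
    obtain ⟨⟨h1, h2, c, hc⟩, h4⟩ := hP
    rw [Finset.mem_biUnion]
    refine ⟨P.natDegree, ?_, mem_monics.2 ⟨h1, rfl⟩⟩
    rw [Finset.mem_range]
    have hc1 : 2 ≤ c := by
      by_contra! hlt
      interval_cases c
      · omega
      · exact h4 ⟨h1, by omega, h2⟩
    have := Nat.mul_le_mul_left P.natDegree hc1
    omega
  have h1 : (1 : ℝ) ≤ Fintype.card F := by exact_mod_cast Fintype.card_pos
  have h2 : (1 : ℝ) ≤ √(Fintype.card F) := Real.one_le_sqrt.2 h1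
  calc ((primesDvd F N \ primes F N).card : ℝ)
      ≤ ∑ d ∈ Finset.range (N / 2 + 1), ((monics F d).card : ℝ) := by
        exact_mod_cast (Finset.card_le_card hsub).trans Finset.card_biUnion_le
    _ ≤ ∑ d ∈ Finset.range (N / 2 + 1), √(Fintype.card F) ^ N := by
        refine Finset.sum_le_sum fun d hd => ?_
        rw [Finset.mem_range] at hd
        rw [card_monics]
        push_cast
        nth_rw 1 [← Real.sq_sqrt (zero_le_one.trans h1)]
        rw [← pow_mul]
        exact pow_le_pow_right₀ h2 (by omega)
    _ ≤ (N + 1) * √(Fintype.card F) ^ N := by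
        rw [Finset.sum_const, Finset.card_range, nsmul_eq_mul]
        refine mul_le_mul_of_nonneg_right ?_ (by positivity)
        have : N / 2 + 1 ≤ N + 1 := by omega
        exact_mod_cast this

lemma norm_mangoldtSum_sub_le (χ : F[X] →* ℂ) (hχ : ∀ g, ‖χ g‖ ≤ 1) {N : ℕ} (hN : 1 ≤ N) :
    ‖mangoldtSum χ N - N * ∑ P ∈ primes F N, χ P‖ ≤ N * ((N + 1) * √(Fintype.card F) ^ N) := by
  classical
  have h1 : (N : ℂ) * ∑ P ∈ primes F N, χ P =
      ∑ P ∈ primes F N, (P.natDegree : ℂ) * χ P ^ (N / P.natDegree) := by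
    rw [Finset.mul_sum]
    refine Finset.sum_congr rfl fun P hP => ?_
    rw [mem_primes] at hP
    rw [hP.2.1, Nat.div_self (by omega), pow_one]
  rw [h1, mangoldtSum, ← Finset.sum_sdiff (primes_subset_primesDvd hN), add_sub_cancel_right]
  refine (norm_sum_le_of_le (f := fun P => (P.natDegree : ℂ) * χ P ^ (N / P.natDegree)) _
    (n := fun _ => (N : ℝ)) fun P hP => ?_).trans ?_
  · rw [Finset.mem_sdiff, mem_primesDvd (by omega)] at hP
    rw [norm_mul, norm_pow, Complex.norm_natCast]
    refine (mul_le_of_le_one_right (by positivity) (pow_le_one₀ (norm_nonneg _) (hχ P))).trans ?_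
    exact_mod_cast Nat.le_of_dvd (by omega) hP.1.2.2
  · rw [Finset.sum_const, nsmul_eq_mul, mul_comm]
    exact mul_le_mul_of_nonneg_left (card_primesDvd_sdiff_le hN) (by positivity)

lemma tendsto_error_div_pow (F : Type*) [Field F] [Fintype F] :
    Tendsto (fun N : ℕ => (N * ((N + 1) * √(Fintype.card F) ^ N)) / (Fintype.card F : ℝ) ^ N)
      atTop (nhds 0) := by
  have h1 : (1 : ℝ) < Fintype.card F := by exact_mod_cast Fintype.one_lt_card
  have h2 : (1 : ℝ) < √(Fintype.card F) := by
    rw [Real.lt_sqrt zero_le_one]; simpa using h1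
  have h3 := (tendsto_pow_const_div_const_pow_of_one_lt 2 h2).add
    (tendsto_pow_const_div_const_pow_of_one_lt 1 h2)
  rw [add_zero] at h3
  refine h3.congr fun N => ?_
  have hs : (Fintype.card F : ℝ) ^ N = √(Fintype.card F) ^ N * √(Fintype.card F) ^ N := by
    rw [← mul_pow, Real.mul_self_sqrt (by positivity)]
  rw [hs]
  have : √(Fintype.card F : ℝ) ^ N ≠ 0 := by positivity
  field_simp

lemma tendsto_mul_card_primes_div_pow (F : Type*) [Field F] [Fintype F] :
    Tendsto (fun N : ℕ => (N * ((primes F N).card : ℝ)) / (Fintype.card F : ℝ) ^ N)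
      atTop (nhds 1) := by
  have hq : (0 : ℝ) < Fintype.card F := by exact_mod_cast Fintype.card_pos
  rw [tendsto_iff_norm_sub_tendsto_zero]
  refine squeeze_zero' (Eventually.of_forall fun N => norm_nonneg _) ?_ (tendsto_error_div_pow F)
  filter_upwards [eventually_ge_atTop 1] with N hN
  have h1 := norm_mangoldtSum_sub_le (1 : F[X] →* ℂ) (by simp) hN
  rw [mangoldtSum_one hN, norm_sub_rev] at h1
  have h2 : (N : ℂ) * ∑ P ∈ primes F N, (1 : F[X] →* ℂ) P - (Fintype.card F : ℂ) ^ N =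
      ((N * ((primes F N).card : ℝ) - (Fintype.card F : ℝ) ^ N : ℝ) : ℂ) := by
    simp
  rw [h2, Complex.norm_real] at h1
  have h3 : N * ((primes F N).card : ℝ) / (Fintype.card F : ℝ) ^ N - 1 =
      (N * ((primes F N).card : ℝ) - (Fintype.card F : ℝ) ^ N) / (Fintype.card F : ℝ) ^ N := by
    field_simp
  rw [h3, norm_div, Real.norm_of_nonneg (by positivity : 0 ≤ (Fintype.card F : ℝ) ^ N)]
  gcongr

lemma card_primes_pos (F : Type*) [Field F] [Fintype F] :
    ∀ᶠ N in atTop, 0 < (primes F N).card := by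
  filter_upwards [(tendsto_mul_card_primes_div_pow F).eventually (lt_mem_nhds one_half_lt_one)]
    with N hN
  rw [Nat.pos_iff_ne_zero]
  intro h
  rw [h] at hN
  norm_num at hN

/-- Prime polynomial theorem for a character whose `L`-function is a polynomial. -/
theorem tendsto_norm_sum_primes_div_card (χ : F[X] →* ℂ) (hχ : ∀ g, ‖χ g‖ ≤ 1) (n₀ : ℕ)
    (hS : ∀ n, n₀ ≤ n → monicSum χ n = 0) :
    Tendsto (fun N : ℕ => ‖∑ P ∈ primes F N, χ P‖ / (primes F N).card) atTop (nhds 0) := by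
  have hq : (0 : ℝ) < Fintype.card F := by exact_mod_cast Fintype.card_pos
  obtain ⟨s, hs⟩ := exists_eq_neg_powerSum (monicSum χ) (mangoldtSum χ) n₀ (monicSum_zero χ) hS
    (natCast_mul_monicSum χ)
  have hnorm : ∀ k, 1 ≤ k → ‖(s.map (· ^ k)).sum‖ = ‖mangoldtSum χ k‖ := fun k hk => by
    rw [hs k hk, norm_neg]
  have hlt := norm_lt_of_powerSum s (Fintype.card F) hq
    (fun k hk => (hnorm k hk).trans_le (norm_mangoldtSum_le χ hχ hk)) (fun w hw => by
      obtain ⟨k, hk, h⟩ := exists_mangoldtSum_ne χ hχ w hw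
      refine ⟨k, hk, fun h' => h ?_⟩
      rw [hs k hk, mul_neg, h', Complex.ofReal_natCast])
  have h1 : Tendsto (fun N : ℕ => (N * ‖∑ P ∈ primes F N, χ P‖) / (Fintype.card F : ℝ) ^ N)
      atTop (nhds 0) := by
    have h2 := (tendsto_powerSum_div_pow s _ hlt).add (tendsto_error_div_pow F)
    rw [add_zero] at h2
    refine squeeze_zero' (Eventually.of_forall fun N => by positivity) ?_ h2
    filter_upwards [eventually_ge_atTop 1] with N hN
    rw [← add_div, hnorm N hN]
    gcongr
    have h3 := norm_mangoldtSum_sub_le χ hχ hN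
    have h4 := norm_sub_norm_le ((N : ℂ) * ∑ P ∈ primes F N, χ P) (mangoldtSum χ N)
    rw [norm_sub_rev, norm_mul, Complex.norm_natCast] at h4
    linarith
  have h5 := h1.div (tendsto_mul_card_primes_div_pow F) one_ne_zero
  rw [zero_div] at h5
  refine h5.congr' ?_
  filter_upwards [eventually_ge_atTop 1, card_primes_pos F] with N hN hc
  have : (N : ℝ) ≠ 0 := by positivity
  have : ((primes F N).card : ℝ) ≠ 0 := by positivity
  simp only [Pi.div_apply]
  field_simp

end Asymptotics

section Resultant

variable {F : Type*} [Field F]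

lemma algebraMap_resultant {E : Type*} [Field E] [Algebra F E] [IsAlgClosed E] {f : F[X]}
    (hf : f.Monic) (g : F[X]) :
    algebraMap F E (resultant f g) = ((f.aroots E).map fun β => aeval β g).prod := by
  have h := resultant_eq_prod_eval (f.map (algebraMap F E)) (g.map (algebraMap F E)) g.natDegree
    natDegree_map_le (IsAlgClosed.splits _)
  rw [natDegree_map, resultant_map_map, (hf.map _).leadingCoeff, one_pow, one_mul] at h
  rw [h]
  simp [aroots_def, eval_map_algebraMap]

/-- The resultant with a fixed monic polynomial `f`, as a multiplicative function. -/
noncomputable def resultantHom (f : F[X]) (hf : f.Monic) : F[X] →* F where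
  toFun g := resultant f g
  map_one' := by simp
  map_mul' g h := by
    apply (algebraMap F (AlgebraicClosure F)).injective
    simp [algebraMap_resultant hf]

lemma resultantHom_apply {f : F[X]} (hf : f.Monic) (g : F[X]) :
    resultantHom f hf g = resultant f g := rfl

lemma resultantHom_mul_left {f g : F[X]} (hf : f.Monic) (hg : g.Monic) (h : F[X]) :
    resultantHom (f * g) (hf.mul hg) h = resultantHom f hf h * resultantHom g hg h := by
  apply (algebraMap F (AlgebraicClosure F)).injective
  simp only [resultantHom_apply, map_mul, algebraMap_resultant hf, algebraMap_resultant hg,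
    algebraMap_resultant (hf.mul hg)]
  rw [aroots_mul (hf.mul hg).ne_zero, Multiset.map_add, Multiset.prod_add]

lemma resultantHom_pow_left {f : F[X]} (hf : f.Monic) (e : ℕ) (h : F[X]) :
    resultantHom (f ^ e) (hf.pow e) h = resultantHom f hf h ^ e := by
  apply (algebraMap F (AlgebraicClosure F)).injective
  simp only [resultantHom_apply, map_pow, algebraMap_resultant hf,
    algebraMap_resultant (hf.pow e)]
  rw [aroots_pow, Multiset.map_nsmul, Multiset.prod_nsmul]

lemma resultantHom_congr {f : F[X]} (hf : f.Monic) {g h : F[X]} (hgh : f ∣ g - h) :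
    resultantHom f hf g = resultantHom f hf h := by
  apply (algebraMap F (AlgebraicClosure F)).injective
  simp only [resultantHom_apply, algebraMap_resultant hf]
  congr 1
  refine Multiset.map_congr rfl fun β hβ => ?_
  obtain ⟨c, hc⟩ := hgh
  rw [← sub_eq_zero, ← map_sub, hc, map_mul, (mem_aroots.1 hβ).2, zero_mul]

lemma resultantHom_C {f : F[X]} (hf : f.Monic) (c : F) :
    resultantHom f hf (C c) = c ^ f.natDegree := by
  rw [resultantHom_apply, natDegree_C, resultant_C_zero_right]

lemma resultantHom_comm {f g : F[X]} (hf : f.Monic) (hg : g.Monic) :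
    resultantHom f hf g = (-1) ^ (f.natDegree * g.natDegree) * resultantHom g hg f :=
  resultant_comm ..

lemma resultantHom_ne_zero_iff {f : F[X]} (hf : f.Monic) {g : F[X]} :
    resultantHom f hf g ≠ 0 ↔ IsCoprime f g := by
  rw [resultantHom_apply, ← isUnit_resultant_iff_isCoprime hf, isUnit_iff_ne_zero]

variable [Finite F]

lemma resultantHom_eq_norm {P : F[X]} (hP : P.Monic) (hirr : Irreducible P) (g : F[X]) :
    resultantHom P hP g = Algebra.norm F (AdjoinRoot.mk P g) := by
  have := Fact.mk hirr
  have hfin : FiniteDimensional F (AdjoinRoot P) := hP.finite_adjoinRoot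
  apply (algebraMap F (AlgebraicClosure F)).injective
  rw [resultantHom_apply, algebraMap_resultant hP,
    Algebra.norm_eq_prod_embeddings F (AlgebraicClosure F)]
  set pb := AdjoinRoot.powerBasis hirr.ne_zero with hpb
  have hmin : minpoly F pb.gen = P := by
    rw [hpb, AdjoinRoot.powerBasis_gen, AdjoinRoot.minpoly_root hirr.ne_zero, hP.leadingCoeff]
    simp
  have hnodup : (P.aroots (AlgebraicClosure F)).Nodup :=
    nodup_roots ((PerfectField.separable_of_irreducible hirr).map)
  classical
  rw [Fintype.prod_equiv pb.liftEquiv' _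
    (fun x : {y // y ∈ (minpoly F pb.gen).aroots (AlgebraicClosure F)} => aeval x.1 g)]
  · rw [Finset.prod_mem_multiset _ _ (fun β => aeval β g) fun _ => rfl, hmin,
      Finset.prod_eq_multiset_prod, Multiset.toFinset_val, hnodup.dedup]
  · intro σ
    rw [PowerBasis.liftEquiv'_apply_coe, aeval_algHom_apply, hpb, AdjoinRoot.powerBasis_gen,
      AdjoinRoot.aeval_eq]

end Resultant

section ResidueSymbol

variable {F : Type*} [Field F] [Fintype F]

lemma powerResidue_eq {m : ℕ} (hm : m ≠ 0) (hmq : m ∣ Fintype.card F - 1) {P : F[X]}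
    (hP : P.Monic) (hirr : Irreducible P) {a : F[X]} {s : F}
    (hs : P ∣ a ^ ((Fintype.card F ^ P.natDegree - 1) / m) - C s) :
    s = resultantHom P hP a ^ ((Fintype.card F - 1) / m) := by
  have := Fact.mk hirr
  have hfin : FiniteDimensional F (AdjoinRoot P) := hP.finite_adjoinRoot
  have hfin' : Finite (AdjoinRoot P) := Module.finite_of_finite F
  have hcard : Nat.card (AdjoinRoot P) = Fintype.card F ^ P.natDegree := by
    rw [Module.natCard_eq_pow_finrank (K := F), (AdjoinRoot.powerBasis hirr.ne_zero).finrank,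
      AdjoinRoot.powerBasis_dim, Nat.card_eq_fintype_card]
  apply (algebraMap F (AdjoinRoot P)).injective
  rw [map_pow, resultantHom_eq_norm hP hirr, FiniteField.algebraMap_norm_eq_pow, hcard,
    Nat.card_eq_fintype_card, ← pow_mul]
  rw [← AdjoinRoot.mk_eq_mk] at hs
  rw [AdjoinRoot.algebraMap_eq, ← AdjoinRoot.mk_C, ← hs, map_pow]
  congr 1
  obtain ⟨c, hc⟩ := hmq
  have hq : 0 < Fintype.card F - 1 := by have := Fintype.one_lt_card (α := F); omega
  have hdvd : Fintype.card F - 1 ∣ Fintype.card F ^ P.natDegree - 1 := by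
    simpa using Nat.sub_dvd_pow_sub_pow (Fintype.card F) 1 P.natDegree
  obtain ⟨d, hd⟩ := hdvd
  rw [hd, Nat.mul_div_cancel_left _ hq, hc, Nat.mul_div_cancel_left _ (by omega),
    mul_assoc, Nat.mul_div_cancel_left _ (by omega), mul_comm]

lemma mulChar_eq_one_iff {m : ℕ} (hm : m ≠ 0) (hmq : m ∣ Fintype.card F - 1)
    {ψ : MulChar F ℂ} (hψ : orderOf ψ = m) {x : F} (hx : x ≠ 0) :
    ψ x = 1 ↔ x ^ ((Fintype.card F - 1) / m) = 1 := by
  obtain ⟨g, hg⟩ := IsCyclic.exists_zpow_surjective (G := Fˣ)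
  have hg' : ∀ y : Fˣ, ∃ j : ℕ, g ^ j = y := fun y =>
    mem_powers_iff_mem_zpowers.2 (Subgroup.mem_zpowers_iff.2 (hg y))
  have hog : orderOf g = Fintype.card F - 1 := by
    classical
    rw [orderOf_eq_card_of_forall_mem_zpowers (fun y => Subgroup.mem_zpowers_iff.2 (hg y)),
      Nat.card_eq_fintype_card, Fintype.card_units]
  have hψg : ∀ k : ℕ, ψ g ^ k = 1 ↔ m ∣ k := by
    intro k
    rw [← hψ, orderOf_dvd_iff_pow_eq_one, MulChar.eq_one_iff]
    constructor
    · intro h y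
      obtain ⟨j, rfl⟩ := hg' y
      rw [MulChar.pow_apply_coe, Units.val_pow_eq_pow_val, map_pow, ← pow_mul, mul_comm, pow_mul,
        h, one_pow]
    · intro h
      rw [← MulChar.pow_apply_coe, h]
  obtain ⟨j, hj⟩ := hg' (Units.mk0 x hx)
  have hxj : x = (g : F) ^ j := by rw [← Units.val_pow_eq_pow_val, hj, Units.val_mk0]
  obtain ⟨c, hc⟩ := hmq
  have hq : 0 < Fintype.card F - 1 := by have := Fintype.one_lt_card (α := F); omega
  have hc0 : 0 < c := Nat.pos_of_ne_zero fun h => by simp [h] at hc; omega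
  rw [hxj, map_pow, hψg, ← pow_mul, ← Units.val_pow_eq_pow_val, Units.val_eq_one,
    ← orderOf_dvd_iff_pow_eq_one, hog, hc, Nat.mul_div_cancel_left _ (by omega)]
  exact (Nat.mul_dvd_mul_iff_right hc0).symm

lemma norm_mulChar_le_one (ψ : MulChar F ℂ) (x : F) : ‖ψ x‖ ≤ 1 := by
  by_cases hx : x = 0
  · simp [hx, MulChar.map_zero]
  · exact (Complex.norm_eq_one_of_pow_eq_one (n := Fintype.card F - 1)
      (by rw [← map_pow, FiniteField.pow_card_sub_one_eq_one x hx, map_one])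
      (by have := Fintype.one_lt_card (α := F); omega)).le

lemma monicSum_eq_zero_of_periodic (χ : F[X] →* ℂ) {f : F[X]} (hf : f.Monic)
    (hper : ∀ g h, f ∣ g - h → χ g = χ h) {r : F[X]} (hr : IsCoprime f r) (hχr : χ r ≠ 1)
    {n : ℕ} (hn : f.natDegree ≤ n) : monicSum χ n = 0 := by
  classical
  set T : F[X] → F[X] := fun g => g + ((r - 1) * g) %ₘ f with hT
  have hTr : ∀ g, f ∣ T g - r * g := by
    intro g
    have := modByMonic_add_div ((r - 1) * g) f
    refine ⟨-(((r - 1) * g) /ₘ f), ?_⟩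
    simp only [hT]
    linear_combination this
  have hmaps : ∀ g ∈ monics F n, T g ∈ monics F n := by
    intro g hg
    rw [mem_monics] at hg ⊢
    have hlt : (((r - 1) * g) %ₘ f).degree < g.degree := by
      refine (degree_modByMonic_lt _ hf).trans_le ?_
      rw [degree_eq_natDegree hf.ne_zero, degree_eq_natDegree hg.1.ne_zero, hg.2]
      exact_mod_cast hn
    exact ⟨hg.1.add_of_left hlt, by rw [natDegree_add_eq_left_of_degree_lt hlt, hg.2]⟩
  have hinj : Set.InjOn T (monics F n) := by
    intro g _ h _ hgh
    have h1 : f ∣ r * (h - g) := by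
      have := dvd_sub (hTr g) (hTr h)
      rw [hgh] at this
      convert this using 1; ring
    have h2 : f ∣ h - g := hr.dvd_of_dvd_mul_left h1
    have h3 : ((r - 1) * h) %ₘ f - ((r - 1) * g) %ₘ f = 0 := by
      rw [← sub_modByMonic, ← mul_sub, modByMonic_eq_zero_iff_dvd hf]
      exact h2.mul_left _
    simp only [hT] at hgh
    linear_combination hgh + h3
  have himage : (monics F n).image T = monics F n :=
    Finset.eq_of_subset_of_card_le (Finset.image_subset_iff.2 hmaps)
      (Finset.card_image_of_injOn hinj).ge
  have h1 : monicSum χ n = χ r * monicSum χ n := by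
    conv_lhs => rw [monicSum, ← himage, Finset.sum_image hinj]
    rw [monicSum, Finset.mul_sum]
    refine Finset.sum_congr rfl fun g _ => ?_
    rw [hper _ _ (hTr g), map_mul]
  have h2 : (χ r - 1) * monicSum χ n = 0 := by rw [sub_mul, ← h1]; ring
  exact (mul_eq_zero.1 h2).resolve_left (sub_ne_zero.2 hχr)

/-- The Dirichlet character `g ↦ ψ (Res(f, g))` modulo `f`. -/
noncomputable def resultantChar (ψ : MulChar F ℂ) (f : F[X]) (hf : f.Monic) : F[X] →* ℂ :=
  ψ.toMonoidHom.comp (resultantHom f hf)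

lemma resultantChar_apply {F : Type*} [Field F] (ψ : MulChar F ℂ) {f : F[X]} (hf : f.Monic)
    (g : F[X]) :
    resultantChar ψ f hf g = ψ (resultantHom f hf g) := rfl

lemma monicSum_resultantChar_eq_zero {m : ℕ} (hm : m.Prime) {ψ : MulChar F ℂ}
    (hψ : orderOf ψ = m) {Q E : F[X]} (hQ : Q.Monic) (hirr : Irreducible Q) (hE : E.Monic)
    (hQE : ¬ Q ∣ E) {e : ℕ} (he : ¬ m ∣ e) {n : ℕ} (hn : (Q ^ e * E).natDegree ≤ n) :
    monicSum (resultantChar ψ (Q ^ e * E) ((hQ.pow e).mul hE)) n = 0 := by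
  have := Fact.mk hirr
  have hfin : FiniteDimensional F (AdjoinRoot Q) := hQ.finite_adjoinRoot
  have hfin' : Finite (AdjoinRoot Q) := Module.finite_of_finite F
  have hψ1 : ψ ≠ 1 := by
    rintro rfl
    rw [orderOf_one] at hψ
    exact hm.one_lt.ne hψ
  obtain ⟨u, hu⟩ := MulChar.ne_one_iff.1 hψ1
  obtain ⟨x, hx⟩ := FiniteField.norm_surjective F (AdjoinRoot Q) (u : F)
  obtain ⟨a, rfl⟩ := AdjoinRoot.mk_surjective x
  obtain ⟨s, t, hst⟩ := (hirr.coprime_iff_not_dvd.2 hQE : IsCoprime Q E)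
  have hval : resultantHom (Q ^ e * E) ((hQ.pow e).mul hE) (a * t * E + s * Q) = (u : F) ^ e := by
    rw [resultantHom_mul_left (hQ.pow e) hE, resultantHom_pow_left hQ,
      resultantHom_congr hQ (h := a) ⟨s - a * s, by linear_combination a * hst⟩,
      resultantHom_congr hE (h := 1) ⟨a * t - t, by linear_combination hst⟩, map_one, mul_one,
      resultantHom_eq_norm hQ hirr, hx]
  refine monicSum_eq_zero_of_periodic _ ((hQ.pow e).mul hE) (r := a * t * E + s * Q)
    (fun g h hgh => by rw [resultantChar_apply, resultantChar_apply, resultantHom_congr _ hgh])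
    ?_ ?_ hn
  · rw [← resultantHom_ne_zero_iff ((hQ.pow e).mul hE), hval]
    exact pow_ne_zero _ u.ne_zero
  · rw [resultantChar_apply, hval, map_pow]
    intro h
    have h1 : ψ u ^ m = 1 := by
      rw [← MulChar.pow_apply_coe, ← hψ, pow_orderOf_eq_one, MulChar.one_apply_coe]
    have h2 := pow_gcd_eq_one.2 ⟨h1, h⟩
    rw [(hm.coprime_iff_not_dvd.2 he).gcd_eq_one, pow_one] at h2
    exact hu h2

end ResidueSymbol

section Main

lemma exists_eq_pow_mul_of_forall_ne_pow {F : Type*} [Field F] {m : ℕ} {G : F[X]} (hG : G.Monic)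
    (h : ∀ H : F[X], G ≠ H ^ m) :
    ∃ (Q E : F[X]) (e : ℕ), Q.Monic ∧ Irreducible Q ∧ E.Monic ∧ ¬ Q ∣ E ∧ ¬ m ∣ e ∧
      G = Q ^ e * E := by
  classical
  have hprod : (UniqueFactorizationMonoid.normalizedFactors G).prod = G := by
    rw [UniqueFactorizationMonoid.prod_normalizedFactors_eq hG.ne_zero, hG.normalize_eq_self]
  obtain ⟨Q, hQ, hcount⟩ : ∃ Q ∈ UniqueFactorizationMonoid.normalizedFactors G,
      ¬ m ∣ (UniqueFactorizationMonoid.normalizedFactors G).count Q := by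
    by_contra! hcon
    obtain ⟨u, hu⟩ := Multiset.exists_smul_of_dvd_count _ hcon
    rw [hu, Multiset.prod_nsmul] at hprod
    exact h _ hprod.symm
  have hirr := UniqueFactorizationMonoid.irreducible_of_normalized_factor Q hQ
  have hQm : Q.Monic := by
    rw [← UniqueFactorizationMonoid.normalize_normalized_factor Q hQ]
    exact monic_normalize hirr.ne_zero
  have hfin : FiniteMultiplicity Q G := FiniteMultiplicity.of_prime_left hirr.prime hG.ne_zero
  obtain ⟨E, hE, hQE⟩ := hfin.exists_eq_pow_mul_and_not_dvd
  refine ⟨Q, E, multiplicity Q G, hQm, hirr, (hQm.pow _).of_mul_monic_left (hE ▸ hG), hQE, ?_, hE⟩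
  have := UniqueFactorizationMonoid.emultiplicity_eq_count_normalizedFactors hirr hG.ne_zero
  rw [hfin.emultiplicity_eq_multiplicity, hQm.normalize_eq_self] at this
  rwa [Nat.cast_inj.1 this]

variable {F : Type*} [Field F] [Fintype F]

lemma tendsto_sum_mulChar_resultant_zero {m : ℕ} (hm : m.Prime) {ψ : MulChar F ℂ}
    (hψ : orderOf ψ = m) {G : F[X]} (hG0 : G ≠ 0) (hG : ∀ c H, G ≠ C c * H ^ m) :
    Tendsto (fun N : ℕ => (∑ P ∈ primes F N, ψ (resultant P G)) / ((primes F N).card : ℂ))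
      atTop (nhds 0) := by
  set c := G.leadingCoeff
  have hc : c ≠ 0 := leadingCoeff_ne_zero.2 hG0
  set f : F[X] := G * C c⁻¹ with hf
  have hfm : f.Monic := monic_mul_leadingCoeff_inv hG0
  have hGf : G = C c * f := by
    rw [hf, mul_left_comm, ← C_mul, mul_inv_cancel₀ hc, C_1, mul_one]
  clear_value f
  obtain ⟨Q, E, e, hQ, hirr, hE, hQE, he, rfl⟩ :=
    exists_eq_pow_mul_of_forall_ne_pow (m := m) hfm fun H hH => hG c H (by rw [hGf, hH])
  have key := tendsto_norm_sum_primes_div_card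
    (resultantChar ψ (Q ^ e * E) ((hQ.pow e).mul hE)) (fun g => norm_mulChar_le_one ψ _)
    _ fun n hn => monicSum_resultantChar_eq_zero hm hψ hQ hirr hE hQE he hn
  refine squeeze_zero_norm (fun N => ?_) key
  rw [norm_div, Complex.norm_natCast]
  refine div_le_div_of_nonneg_right ?_ (Nat.cast_nonneg _)
  have hsum : ∑ P ∈ primes F N, ψ (resultant P G) =
      ψ (c ^ N * (-1) ^ (N * (Q ^ e * E).natDegree)) *
        ∑ P ∈ primes F N, resultantChar ψ (Q ^ e * E) ((hQ.pow e).mul hE) P := by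
    rw [Finset.mul_sum]
    refine Finset.sum_congr rfl fun P hP => ?_
    obtain ⟨hP1, rfl, hP2⟩ := mem_primes.1 hP
    rw [← resultantHom_apply hP1, hGf, map_mul (resultantHom P hP1), resultantHom_C,
      resultantHom_comm hP1 hfm, resultantChar_apply, ← map_mul, mul_assoc]
  rw [hsum, norm_mul]
  exact mul_le_of_le_one_left (norm_nonneg _) (norm_mulChar_le_one ψ _)

lemma resultant_ne_zero_of_mem_primes {N : ℕ} {P G : F[X]} (hP : P ∈ primes F N) (hG : G ≠ 0)
    (hN : G.natDegree < N) : resultant P G ≠ 0 := by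
  obtain ⟨hP1, rfl, hP2⟩ := mem_primes.1 hP
  rw [← resultantHom_apply hP1, resultantHom_ne_zero_iff, hP2.coprime_iff_not_dvd]
  exact fun h => hN.not_ge (natDegree_le_of_dvd h hG)

lemma mulChar_pow_eq_one {F : Type*} [Field F] {m : ℕ} {ψ : MulChar F ℂ}
    (hψ : orderOf ψ = m) {x : F} (hx : x ≠ 0) :
    ψ x ^ m = 1 := by
  have := MulChar.pow_apply_coe ψ m (Units.mk0 x hx)
  rw [Units.val_mk0] at this
  rw [← this, ← hψ, pow_orderOf_eq_one, ← Units.val_mk0 hx, MulChar.one_apply_coe]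

lemma tendsto_sum_mulChar_resultant_one {m : ℕ} {ψ : MulChar F ℂ}
    (hψ : orderOf ψ = m) {H : F[X]} (hH : H ≠ 0) :
    Tendsto (fun N : ℕ => (∑ P ∈ primes F N, ψ (resultant P (H ^ m))) / ((primes F N).card : ℂ))
      atTop (nhds 1) := by
  refine tendsto_const_nhds.congr' ?_
  filter_upwards [eventually_gt_atTop H.natDegree, card_primes_pos F] with N hN hcard
  have hone : ∀ P ∈ primes F N, ψ (resultant P (H ^ m)) = 1 := by
    intro P hP
    have hP1 := (mem_primes.1 hP).1
    rw [← resultantHom_apply hP1, map_pow, map_pow]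
    exact mulChar_pow_eq_one hψ (resultant_ne_zero_of_mem_primes hP hH hN)
  rw [Finset.sum_congr rfl hone, Finset.sum_const, nsmul_eq_mul, mul_one, div_self]
  exact_mod_cast hcard.ne'

open Classical in
lemma sum_mulChar_prod_pow {F : Type*} [Field F] {m l : ℕ} {ψ : MulChar F ℂ}
    (hψ : orderOf ψ = m)
    {z : Fin l → F} (hz : ∀ i, z i ≠ 0) :
    ∑ a : Fin l → Fin m, ψ (∏ i, z i ^ (a i : ℕ)) =
      if ∀ i, ψ (z i) = 1 then (m : ℂ) ^ l else 0 := by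
  have h1 : ∀ i, ∑ j : Fin m, ψ (z i) ^ (j : ℕ) = if ψ (z i) = 1 then (m : ℂ) else 0 := by
    intro i
    rw [Fin.sum_univ_eq_sum_range (fun j => ψ (z i) ^ j)]
    split_ifs with h
    · simp [h]
    · rw [geom_sum_eq h, mulChar_pow_eq_one hψ (hz i), sub_self, zero_div]
  simp only [map_prod, map_pow]
  rw [← Fintype.piFinset_univ, ← Finset.prod_univ_sum (fun _ => Finset.univ)
    (fun i (j : Fin m) => ψ (z i) ^ (j : ℕ))]
  simp only [h1]
  split_ifs with h
  · simp [h]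
  · obtain ⟨i, hi⟩ := not_forall.1 h
    exact Finset.prod_eq_zero (Finset.mem_univ i) (if_neg hi)

lemma exists_eq_pow_of_eq_C_mul_pow {F : Type*} [Field F] {m : ℕ} (hm : 0 < m)
    {K : Type*} [Field K] [Algebra (RatFunc F) K] [Algebra F K] [IsScalarTower F (RatFunc F) K]
    (hgeo : ∀ x : K, IsAlgebraic F x → ∃ c : F, algebraMap F K c = x)
    {G : F[X]} (hG : G ≠ 0) {z : K}
    (hz : z ^ m = algebraMap (RatFunc F) K (algebraMap F[X] (RatFunc F) G)) {c : F} {H : F[X]}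
    (h : G = C c * H ^ m) : ∃ H' : F[X], G = H' ^ m := by
  have hH : H ≠ 0 := by
    rintro rfl
    simp [hm.ne'] at h
    exact hG h
  set φ : F[X] →+* K := (algebraMap (RatFunc F) K).comp (algebraMap F[X] (RatFunc F)) with hφ
  have hφH : φ H ≠ 0 := by
    simpa [hφ] using hH
  have hφC : φ (C c) = algebraMap F K c := by
    rw [IsScalarTower.algebraMap_apply F (RatFunc F) K,
      IsScalarTower.algebraMap_apply F F[X] (RatFunc F)]
    rfl
  have hpow : (z / φ H) ^ m = algebraMap F K c := by
    have hz' : z ^ m = φ G := hz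
    rw [div_pow, hz', h, map_mul, map_pow, mul_div_cancel_right₀ _ (pow_ne_zero _ hφH), hφC]
  obtain ⟨c', hc'⟩ := hgeo (z / φ H) ⟨X ^ m - C c, X_pow_sub_C_ne_zero hm c, by simp [hpow]⟩
  rw [← hc', ← map_pow] at hpow
  exact ⟨C c' * H, by rw [h, mul_pow, ← C_pow, (algebraMap F K).injective hpow]⟩

lemma natCard_primes (N : ℕ) (p : F[X] → Prop) [DecidablePred p] :
    Nat.card {P : F[X] // P.Monic ∧ Irreducible P ∧ P.natDegree = N ∧ p P} =
      ((primes F N).filter p).card := by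
  rw [← Nat.card_eq_finsetCard]
  refine Nat.card_congr (Equiv.subtypeEquivRight fun P => ?_)
  rw [Finset.mem_filter, mem_primes]
  tauto

end Main

end KummerDensity

open KummerDensity

/-- **Relative density of simultaneous `m`-th power residues (Theorem 2.4).**
Let `q` be a prime power, `k = F_q(t)`, `m` a prime divisor of `q−1`, and
`S = {D_1,...,D_l}` nonzero polynomials in `F_q[t]` such that
`K = k(D_1^{1/m},...,D_l^{1/m})` is a geometric extension of `k`.  Let `γ_S` be the
cardinality of `{(a_1,...,a_l) ∈ {0,...,m−1}^l : D_1^{a_1}···D_l^{a_l}` is an `m`-th power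
in `F_q[t]}`.  Let `M` be the set of monic irreducible `P ∈ F_q[t]` with
`(D_1/P)_m = ⋯ = (D_l/P)_m = 1`.  Then the relative density of `M` exists and equals
`γ_S / m^l`, i.e. `#{P ∈ M : deg P = N}/π(N) → γ_S/m^l` as `N → ∞`. -/
theorem kummer_relative_density
    (p e : ℕ) (hp : p.Prime) (he : 0 < e)
    (Fq : Type) [Field Fq] [Fintype Fq] (hq : Fintype.card Fq = p ^ e)
    (m : ℕ) (hm : m.Prime) (hmq : m ∣ Fintype.card Fq - 1)
    (l : ℕ) (D : Fin l → Polynomial Fq) (hD : ∀ i, D i ≠ 0)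
    -- the m-th power residue symbol `(a/P)_m ∈ F_q`
    (sym : Polynomial Fq → Polynomial Fq → Fq)
    (hsym0 : ∀ P a : Polynomial Fq, P ∣ a → sym P a = 0)
    (hsym1 : ∀ P a : Polynomial Fq, P.Monic → Irreducible P → ¬ P ∣ a →
      P ∣ (a ^ ((Fintype.card Fq ^ P.natDegree - 1) / m) - C (sym P a)))
    -- `K = k(D_1^{1/m},...,D_l^{1/m})`, a geometric extension of `k`
    (K : Type) [Field K] [Algebra (RatFunc Fq) K] [Algebra Fq K]
    [IsScalarTower Fq (RatFunc Fq) K]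
    (y : Fin l → K)
    (hy : ∀ i, y i ^ m =
      algebraMap (RatFunc Fq) K (algebraMap (Polynomial Fq) (RatFunc Fq) (D i)))
    (hgen : Algebra.adjoin (RatFunc Fq) (Set.range y) = ⊤)
    (hgeo : ∀ x : K, IsAlgebraic Fq x → ∃ c : Fq, algebraMap Fq K c = x) :
    Tendsto (fun N : ℕ =>
        (Nat.card {P : Polynomial Fq //
            P.Monic ∧ Irreducible P ∧ P.natDegree = N ∧ ∀ i, sym P (D i) = 1} : ℝ) /
          (Nat.card {P : Polynomial Fq // P.Monic ∧ Irreducible P ∧ P.natDegree = N} : ℝ))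
      atTop
      (nhds ((Nat.card {a : Fin l → Fin m //
          ∃ F : Polynomial Fq, (∏ i, D i ^ (a i : ℕ)) = F ^ m} : ℝ) / (m : ℝ) ^ l)) := by
  classical
  have hm0 := hm.ne_zero
  obtain ⟨ψ, hψ⟩ := MulChar.exists_mulChar_orderOf Fq hmq (Complex.isPrimitiveRoot_exp m hm0)
  set G : (Fin l → Fin m) → Fq[X] := fun a => ∏ i, D i ^ (a i : ℕ) with hG
  have hG0 : ∀ a, G a ≠ 0 := fun a => Finset.prod_ne_zero_iff.2 fun i _ => pow_ne_zero _ (hD i)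
  have hroot : ∀ a, (∏ i, y i ^ (a i : ℕ)) ^ m =
      algebraMap (RatFunc Fq) K (algebraMap Fq[X] (RatFunc Fq) (G a)) := by
    intro a
    simp only [hG, map_prod, map_pow, ← hy, ← Finset.prod_pow]
    exact Finset.prod_congr rfl fun i _ => pow_right_comm _ _ _
  have hlim : ∀ a, Tendsto
      (fun N : ℕ => (∑ P ∈ primes Fq N, ψ (resultant P (G a))) / ((primes Fq N).card : ℂ)) atTop
      (nhds (if ∃ F, G a = F ^ m then 1 else 0)) := by
    intro a
    split_ifs with h
    · obtain ⟨H, hH⟩ := h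
      rw [hH]
      exact tendsto_sum_mulChar_resultant_one hψ fun h0 => hG0 a (by rw [hH, h0, zero_pow hm0])
    · exact tendsto_sum_mulChar_resultant_zero hm hψ (hG0 a) fun c H hcH =>
        h (exists_eq_pow_of_eq_C_mul_pow hm.pos hgeo (hG0 a) (hroot a) hcH)
  have hsum := (tendsto_finsetSum Finset.univ fun a _ => hlim a).div_const ((m : ℂ) ^ l)
  have hγ : ∑ a, (if ∃ F, G a = F ^ m then (1 : ℂ) else 0) =
      Nat.card {a : Fin l → Fin m // ∃ F, G a = F ^ m} := by
    rw [Finset.sum_boole, Nat.card_eq_fintype_card, Fintype.card_subtype]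
  rw [hγ] at hsum
  rw [← Filter.tendsto_ofReal_iff]
  push_cast
  refine hsum.congr' ?_
  filter_upwards [eventually_all.2 fun i => eventually_gt_atTop (D i).natDegree] with N hN
  have hsymm : ∀ P ∈ primes Fq N,
      ∑ a, ψ (resultant P (G a)) = if ∀ i, sym P (D i) = 1 then (m : ℂ) ^ l else 0 := by
    intro P hP
    obtain ⟨hP1, hPN, hP2⟩ := mem_primes.1 hP
    have hres : ∀ i, resultant P (D i) ≠ 0 := fun i =>
      resultant_ne_zero_of_mem_primes hP (hD i) (hN i)
    have hiff : ∀ i, sym P (D i) = 1 ↔ ψ (resultant P (D i)) = 1 := by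
      intro i
      have hdvd : ¬ P ∣ D i := fun h =>
        (hN i).not_ge (hPN ▸ natDegree_le_of_dvd h (hD i))
      rw [mulChar_eq_one_iff hm0 hmq hψ (hres i),
        powerResidue_eq hm0 hmq hP1 hP2 (hsym1 P (D i) hP1 hP2 hdvd), resultantHom_apply]
    simp only [hiff]
    rw [← sum_mulChar_prod_pow hψ hres]
    refine Finset.sum_congr rfl fun a _ => ?_
    rw [← resultantHom_apply hP1]
    simp only [hG, map_prod, map_pow, resultantHom_apply]
  have hcard : Nat.card {P : Fq[X] // P.Monic ∧ Irreducible P ∧ P.natDegree = N} =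
      (primes Fq N).card := by
    simpa using natCard_primes (F := Fq) N fun _ => True
  rw [natCard_primes, hcard, ← Finset.sum_div, Finset.sum_comm, Finset.sum_congr rfl hsymm,
    ← Finset.sum_filter, Finset.sum_const, nsmul_eq_mul, div_right_comm,
    mul_div_cancel_right₀ _ (pow_ne_zero _ (Nat.cast_ne_zero.2 hm0))]
end

section
/- Let q be a power of a prime p, k = F_q(t), and n ∈ k a nonzero element such that E = k(α) with α^p − α = n is a geometric Artin-Schreier extension of k of degree p. For a monic irreducible P ∈ F_q[t] with ord_P(n) ≥ 0, let {n/P} = tr_{F_q/F_p}(tr_{(F_q[t]/P)/F_q}(n mod P)) ∈ F_p be the Hasse symbol, and let {{n/P}} = exp(2πi·{n/P}/p) ∈ C. Then, as N → ∞, the sum over monic irreducible polynomials P of degree N (with ord_P(n) ≥ 0) of [{{n/P}} + {{n/P}}^2 + ··· + {{n/P}}^{p−1}] is o(π(N)), where π(N) is the number of monic irreducible polynomials of degree N in F_q[t]; more precisely, this sum is O(q^{N/2}/N). -/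
open Polynomial Filter

/-- The Hasse symbol `{D/P} ∈ F_p` of `D ∈ F_q(t)` at a monic irreducible `P ∈ F_q[t]`
(meaningful when `ord_P(D) ≥ 0`, i.e. `P ∤ denom(D)`), defined as
`tr_{F_q/F_p}(tr_{(F_q[t]/(P))/F_q}(D mod P))`, where `D mod P` is computed as
`num(D)·denom(D)⁻¹` in `F_q[t]/(P)`. -/
noncomputable def hasseSymbol (p : ℕ) {Fq : Type} [Field Fq] [Fintype Fq]
    [Algebra (ZMod p) Fq] (P : Polynomial Fq) (D : RatFunc Fq) : ZMod p :=
  Algebra.trace (ZMod p) Fq (Algebra.trace Fq (AdjoinRoot P)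
    (AdjoinRoot.mk P D.num * Ring.inverse (AdjoinRoot.mk P D.denom)))

/-- The complex-valued symbol `{{D/P}} = exp(2πi·{D/P}/p)`. -/
noncomputable def hasseChar (p : ℕ) {Fq : Type} [Field Fq] [Fintype Fq]
    [Algebra (ZMod p) Fq] (P : Polynomial Fq) (D : RatFunc Fq) : ℂ :=
  Complex.exp (2 * Real.pi * Complex.I * ((hasseSymbol p P D).val : ℂ) / p)

/-- Over any algebraic function field there is a place above `X = 0`. -/
theorem exists_valuation_lt_one {K L : Type} [Field K] [Field L] [Algebra K L] (u : L)
    (hu : Transcendental K u) :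
    ∃ B : ValuationSubring L, B.valuation.IsTrivialOn K ∧ B.valuation u < 1 := by
  have hinj : Function.Injective (aeval (R := K) u) := transcendental_iff_injective.mp hu
  let A : Subring L := (aeval (R := K) u).toRingHom.range
  have hu_mem : u ∈ A := ⟨X, by simp⟩
  have hI : Ideal.span {(⟨u, hu_mem⟩ : A)} ≠ ⊤ := by
    rw [Ne, Ideal.span_singleton_eq_top]
    intro h
    obtain ⟨⟨w, f, hf⟩, hw⟩ := isUnit_iff_exists_inv.mp h
    have h1 : u * w = 1 := congrArg Subtype.val hw
    have h2 : aeval u (X * f) = aeval u (1 : K[X]) := by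
      rw [map_mul, aeval_X, map_one, ← h1, ← hf]; rfl
    have h3 := congrArg (eval 0) (hinj h2)
    simp at h3
  obtain ⟨B, hAB, hIB⟩ := Ideal.image_subset_nonunits_valuationSubring _ hI
  have hK (c : K) : algebraMap K L c ∈ B := hAB ⟨C c, by simp⟩
  refine ⟨B, ⟨fun c hc ↦ le_antisymm ((B.valuation_le_one_iff _).mpr (hK c)) ?_⟩, ?_⟩
  · have := (B.valuation_le_one_iff _).mpr (hK c⁻¹)
    rw [map_inv₀, map_inv₀] at this
    exact (inv_le_one₀ (by simpa [zero_lt_iff] using hc)).mp this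
  · exact B.mem_nonunits_iff.mp (hIB ⟨_, Ideal.mem_span_singleton_self _, rfl⟩)

theorem Valuation.sum_ne_zero_of_injOn {R Γ ι : Type*} [CommRing R]
    [LinearOrderedCommGroupWithZero Γ] (v : Valuation R Γ) (s : Finset ι) (f : ι → R)
    (hs : s.Nonempty) (h0 : ∀ i ∈ s, v (f i) ≠ 0)
    (hinj : Set.InjOn (fun i ↦ v (f i)) s) : ∑ i ∈ s, f i ≠ 0 := by
  classical
  obtain ⟨j, hj, hmax⟩ := s.exists_max_image (fun i ↦ v (f i)) hs
  intro h
  apply h0 j hj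
  rw [← Valuation.map_sum_eq_of_lt v hj, h, map_zero]
  intro i hi
  rw [Finset.mem_sdiff, Finset.mem_singleton] at hi
  exact lt_of_le_of_ne (hmax i hi.1) fun h' ↦ hi.2 (hinj hi.1 hj h')

/-- If `y` has valuation of denominator exactly `p`, the monomials `z ^ (r + i Q) y ^ (j + k Q)`
have pairwise distinct valuations, hence are linearly independent over the constants. -/
theorem sum_frobenius_monomials_ne_zero {K L Γ : Type*} [Field K] [Field L] [Algebra K L]
    [LinearOrderedCommGroupWithZero Γ] (v : Valuation L Γ) [v.IsTrivialOn K]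
    {p : ℕ} (hp : p.Prime) {d : ℤ} (hd : ¬ (p : ℤ) ∣ d) {z y : L} (hz : z ≠ 0) (hz1 : v z ≠ 1)
    (hy : v y ^ p = v z ^ d) {l m Q : ℕ} (hpQ : p ∣ Q) (hlQ : p * l < Q)
    (c : Fin (l + 1) × Fin (m + 1) × Fin p × Fin p → K) (hc : c ≠ 0) :
    ∑ t, algebraMap K L (c t) *
      (z ^ (t.1.val + t.2.1.val * Q) * y ^ (t.2.2.1.val + t.2.2.2.val * Q)) ≠ 0 := by
  classical
  have hv0 : v z ≠ 0 := by simpa using hz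
  have hy0 : v y ≠ 0 := by
    intro h
    rw [h, zero_pow hp.ne_zero] at hy
    exact zpow_ne_zero d hv0 hy.symm
  have hval (t : Fin (l + 1) × Fin (m + 1) × Fin p × Fin p) (ht : c t ≠ 0) :
      v (algebraMap K L (c t) *
        (z ^ (t.1.val + t.2.1.val * Q) * y ^ (t.2.2.1.val + t.2.2.2.val * Q))) ^ p =
      v z ^ ((p * (t.1.val + t.2.1.val * Q) + d * (t.2.2.1.val + t.2.2.2.val * Q) : ℤ)) := by
    rw [map_mul, Valuation.IsTrivialOn.eq_one _ ht, one_mul, map_mul, map_pow, map_pow, mul_pow,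
      ← pow_mul, ← pow_mul, zpow_add₀ hv0, zpow_mul, zpow_mul, ← hy, mul_comm _ p, mul_comm _ p,
      pow_mul, pow_mul]
    norm_cast
  rw [← Finset.sum_filter_of_ne (p := fun t ↦ c t ≠ 0)
    (fun t _ ht h ↦ ht (by rw [h]; simp))]
  apply v.sum_ne_zero_of_injOn
  · obtain ⟨t, ht⟩ := Function.ne_iff.mp hc
    exact ⟨t, by simpa using ht⟩
  · intro t ht h
    have := hval t (Finset.mem_filter.mp ht).2
    rw [h, zero_pow hp.ne_zero] at this
    exact zpow_ne_zero _ hv0 this.symm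
  · intro s hs t ht hst
    have h1 := (hval s (Finset.mem_filter.mp hs).2).symm.trans
      ((congrArg (· ^ p) hst).trans (hval t (Finset.mem_filter.mp ht).2))
    have h2 := zpow_right_injective₀ (zero_lt_iff.mpr hv0) hz1 h1
    obtain ⟨⟨r, hr⟩, ⟨i, hi⟩, ⟨j, hj⟩, ⟨k, hk⟩⟩ := s
    obtain ⟨⟨r', hr'⟩, ⟨i', hi'⟩, ⟨j', hj'⟩, ⟨k', hk'⟩⟩ := t
    simp only at h2
    have hpZ : Prime (p : ℤ) := Nat.prime_iff_prime_int.mp hp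
    have small {a b : ℕ} (ha : a < p) (hb : b < p) (h : (p : ℤ) ∣ d * ((a : ℤ) - b)) : a = b := by
      rcases hpZ.dvd_or_dvd h with h | h
      · exact absurd h hd
      · have := Int.eq_zero_of_abs_lt_dvd h (by rw [abs_lt]; constructor <;> omega)
        omega
    obtain ⟨w, rfl⟩ := hpQ
    push_cast at h2
    have hjj : j = j' := small hj hj'
      ⟨(r' + i' * (p * w) - (r + i * (p * w))) + d * (k' * w - k * w), by linear_combination h2⟩
    subst hjj
    have hQ : ((p * w : ℕ) : ℤ) ∣ p * ((r : ℤ) - r') :=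
      ⟨(p * (i' - i) + d * (k' - k)), by push_cast; linear_combination h2⟩
    have hpos : (0 : ℤ) < p := by exact_mod_cast hp.pos
    have hrr : (p : ℤ) * ((r : ℤ) - r') = 0 := by
      apply Int.eq_zero_of_abs_lt_dvd hQ
      rw [abs_mul, abs_of_pos hpos]
      have : |(r : ℤ) - r'| ≤ l := by rw [abs_le]; constructor <;> omega
      calc (p : ℤ) * |(r : ℤ) - r'| ≤ p * l := by gcongr
        _ < _ := by exact_mod_cast hlQ
    have hr2 : (r : ℤ) = r' := by
      rcases mul_eq_zero.mp hrr with h | h <;> omega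
    rw [hr2] at h2
    have hpw : (p * w : ℤ) ≠ 0 := by
      have : 0 < p * w := by omega
      exact_mod_cast this.ne'
    have h3 : (p : ℤ) * (i - i') + d * (k - k') = 0 := by
      apply mul_left_cancel₀ hpw
      linear_combination h2
    have hkk : k = k' := small hk hk' ⟨i' - i, by linear_combination h3⟩
    subst hkk
    have hii : (i : ℤ) = i' := by
      apply mul_left_cancel₀ hpos.ne'
      linear_combination h3
    norm_cast at hr2 hii
    subst hr2 hii
    rfl

theorem exists_rootMultiplicity_not_dvd {K : Type*} [Field K] [IsAlgClosed K] {p : ℕ} [CharP K p]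
    (hp : p.Prime) {D : K[X]} (hD : derivative D ≠ 0) :
    ∃ a, ¬ p ∣ D.rootMultiplicity a := by
  classical
  by_contra! h
  apply hD
  have hroots := (IsAlgClosed.splits D).eq_prod_roots
  rw [prod_multiset_root_eq_finset_root] at hroots
  choose e he using h
  obtain ⟨b, hb⟩ := IsAlgClosed.exists_pow_nat_eq D.leadingCoeff hp.pos
  have : D = (C b * ∏ a ∈ D.roots.toFinset, (X - C a) ^ e a) ^ p := by
    conv_lhs => rw [hroots, ← hb]
    rw [mul_pow, ← C_pow, ← Finset.prod_pow]
    congr 1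
    exact Finset.prod_congr rfl fun a _ ↦ by rw [he a, mul_comm, pow_mul]
  rw [this, derivative_pow]
  simp

/-- A curve `D(x) (y ^ p - y) = A(x)` with a totally ramified place has a generic point at which
the Frobenius monomials in `x - a` and `y` are linearly independent. -/
theorem exists_generic_point {K : Type} [Field K] [IsAlgClosed K] {p : ℕ} [CharP K p]
    (hp : p.Prime) {A D : K[X]}
    (h : (IsCoprime A D ∧ derivative D ≠ 0) ∨ (D = 1 ∧ ¬ p ∣ A.natDegree)) :
    ∃ (a : K) (L : Type) (_ : Field L) (_ : Algebra K L) (x y : L),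
      aeval x D ≠ 0 ∧ aeval x D * (y ^ p - y) = aeval x A ∧
      ∀ l m Q : ℕ, p ∣ Q → p * l < Q →
        ∀ c : Fin (l + 1) × Fin (m + 1) × Fin p × Fin p → K, c ≠ 0 →
          ∑ t, algebraMap K L (c t) * ((x - algebraMap K L a) ^ (t.1.val + t.2.1.val * Q) *
            y ^ (t.2.2.1.val + t.2.2.2.val * Q)) ≠ 0 := by
  let F := FractionRing K[X]
  let L := AlgebraicClosure F
  let u : L := algebraMap F L (algebraMap K[X] F X)
  have hu : Transcendental K u := by
    exact (transcendental_algebraMap_iff (algebraMap F L).injective).mpr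
      ((transcendental_algebraMap_iff (IsFractionRing.injective K[X] F)).mpr (transcendental_X K))
  obtain ⟨B, hB, hu1⟩ := exists_valuation_lt_one u hu
  have hu0 : u ≠ 0 := fun h ↦ hu (h ▸ isAlgebraic_zero)
  set v := B.valuation
  have hy (x : L) : ∃ y : L, aeval x D ≠ 0 → aeval x D * (y ^ p - y) = aeval x A := by
    have hdeg : (X ^ p - X - C (aeval x A / aeval x D) : L[X]).degree ≠ 0 := by
      have h1 : (X + C (aeval x A / aeval x D) : L[X]).degree < p := by
        rw [degree_X_add_C]; exact_mod_cast hp.one_lt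
      rw [sub_sub, degree_sub_eq_left_of_degree_lt (by rwa [degree_X_pow]), degree_X_pow]
      exact_mod_cast hp.ne_zero
    obtain ⟨y, hy⟩ := IsAlgClosed.exists_root _ hdeg
    refine ⟨y, fun h0 ↦ ?_⟩
    have : y ^ p - y = aeval x A / aeval x D := by
      simpa [sub_eq_zero] using hy
    rw [this, mul_div_cancel₀ _ h0]
  have hvy (w y : L) (hw : 1 < v w) (h : y ^ p - y = w) : v y ^ p = v w := by
    have hy1 : 1 < v y := by
      by_contra! hy1
      have : v w ≤ 1 := by
        rw [← h]
        exact (v.map_sub _ _).trans (max_le (by rw [map_pow]; exact pow_le_one' hy1 p) hy1)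
      exact absurd hw this.not_gt
    rw [← h, v.map_sub_eq_of_lt_left, map_pow]
    rw [map_pow]
    exact lt_self_pow₀ hy1 hp.one_lt
  rcases h with ⟨hcop, hder⟩ | ⟨rfl, hdeg⟩
  · obtain ⟨a, ha⟩ := exists_rootMultiplicity_not_dvd hp hder
    have hD0 : D ≠ 0 := by rintro rfl; simp at hder
    set e := D.rootMultiplicity a
    have he : e ≠ 0 := fun h ↦ ha (h ▸ dvd_zero p)
    have hroot : D.eval a = 0 := by
      by_contra h
      exact he (rootMultiplicity_eq_zero h)
    let x : L := u + algebraMap K L a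
    have hxa : x - algebraMap K L a = u := by simp [x]
    have hx1 : x ∈ B := B.add_mem _ _ ((B.valuation_le_one_iff _).mp hu1.le)
      ((B.valuation_le_one_iff _).mp (Valuation.IsTrivialOn.valuation_algebraMap_le_one v a))
    have hmem (g : K[X]) : aeval x g ∈ B := by
      induction g using Polynomial.induction_on' with
      | add f g hf hg => rw [map_add]; exact B.add_mem _ _ hf hg
      | monomial n c =>
        rw [aeval_monomial]
        exact B.mul_mem _ _ ((B.valuation_le_one_iff _).mp
          (Valuation.IsTrivialOn.valuation_algebraMap_le_one v c)) (pow_mem hx1 n)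
    have hunit (f : K[X]) (hf : f.eval a ≠ 0) : v (aeval x f) = 1 := by
      obtain ⟨g, hg⟩ := X_sub_C_dvd_sub_C_eval (a := a) (p := f)
      have h1 : aeval x f = u * aeval x g + algebraMap K L (f.eval a) := by
        have := congrArg (aeval x) hg
        rw [map_sub, map_mul, map_sub, aeval_X, aeval_C, aeval_C, hxa, sub_eq_iff_eq_add] at this
        exact this
      have hg1 : v (aeval x g) ≤ 1 := (B.valuation_le_one_iff _).mpr (hmem g)
      rw [h1, v.map_add_eq_of_lt_right, hB.eq_one _ hf]
      rw [hB.eq_one _ hf, map_mul]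
      exact mul_lt_one_of_lt_of_le hu1 hg1
    obtain ⟨D', hD', hD'dvd⟩ := exists_eq_pow_rootMultiplicity_mul_and_not_dvd D hD0 a
    have hD'a : D'.eval a ≠ 0 := fun h ↦ hD'dvd (dvd_iff_isRoot.mpr h)
    have hAa : A.eval a ≠ 0 := by
      obtain ⟨s, t, hst⟩ := hcop
      intro hA
      have := congrArg (eval a) hst
      simp [hA, hroot] at this
    have hvD : v (aeval x D) = v u ^ e := by
      rw [hD', map_mul, map_mul, hunit D' hD'a, mul_one, map_pow, map_pow, map_sub, aeval_X,
        aeval_C, hxa]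
    have hv0 : v u ≠ 0 := by simpa using hu0
    have hDx : aeval x D ≠ 0 := by
      intro h
      rw [h, map_zero] at hvD
      exact pow_ne_zero e hv0 hvD.symm
    obtain ⟨y, hy⟩ := hy x
    have hyD := hy hDx
    have hw : v (aeval x A / aeval x D) = v u ^ (-(e : ℤ)) := by
      rw [map_div₀, hunit A hAa, hvD, one_div, zpow_neg, zpow_natCast]
    refine ⟨a, L, inferInstance, inferInstance, x, y, hDx, hyD, ?_⟩
    intro l m Q hpQ hlQ c hc
    rw [hxa]
    refine sum_frobenius_monomials_ne_zero v hp (d := -(e : ℤ)) ?_ hu0 hu1.ne ?_ hpQ hlQ c hc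
    · rw [dvd_neg]; exact_mod_cast ha
    · rw [← hw]
      refine hvy _ _ ?_ (eq_div_of_mul_eq hDx (by rw [mul_comm, hyD]))
      rw [hw, zpow_neg, zpow_natCast]
      exact (one_lt_inv₀ (pow_pos (zero_lt_iff.mpr hv0) e)).mpr (pow_lt_one₀ zero_le hu1 he)
  · let x : L := u⁻¹
    have hx1 : 1 < v x := by
      rw [map_inv₀]
      exact (one_lt_inv₀ (zero_lt_iff.mpr (by simpa using hu0))).mpr hu1
    have hA0 : A ≠ 0 := by rintro rfl; simp at hdeg
    have hdeg0 : A.natDegree ≠ 0 := fun h ↦ hdeg (h ▸ dvd_zero p)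
    have hvA : v (aeval x A) = v x ^ A.natDegree :=
      Polynomial.valuation_aeval_eq_valuation_X_pow_natDegree_of_one_lt_valuation_X x hx1 hA0
    obtain ⟨y, hy⟩ := hy x
    have hyD := hy (by simp)
    refine ⟨0, L, inferInstance, inferInstance, x, y, by simp, hyD, ?_⟩
    intro l m Q hpQ hlQ c hc
    rw [map_zero, sub_zero]
    refine sum_frobenius_monomials_ne_zero v hp (d := A.natDegree) (by exact_mod_cast hdeg)
      (inv_ne_zero hu0) hx1.ne' ?_ hpQ hlQ c hc
    rw [zpow_natCast, ← hvA]
    refine hvy _ _ ?_ (by simpa using hyD)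
    rw [hvA]
    exact one_lt_pow₀ hx1 hdeg0

/-- Reduction of polynomials in `y` modulo the Artin–Schreier equation `D(x) (y ^ p - y) = A(x)`,
with control of the degrees in `x`. -/
theorem exists_reduction {K : Type*} [Field K] {p : ℕ} (hp : 1 < p) {A D : K[X]} {δ : ℕ}
    (hA : A.natDegree ≤ δ) (hD : D.natDegree ≤ δ) (E : ℕ) :
    ∀ g : K[X], g.natDegree ≤ E → ∃ c : ℕ → K[X], (∀ s, (c s).natDegree ≤ E * δ) ∧
      ∀ (L : Type) [Field L] [Algebra K L] (x y : L),
        aeval x D * (y ^ p - y) = aeval x A →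
        aeval x D ^ E * aeval y g = ∑ s ∈ Finset.range p, aeval x (c s) * y ^ s := by
  obtain ⟨n, rfl⟩ : ∃ n, p = n + 2 := ⟨p - 2, by omega⟩
  induction E with
  | zero =>
    intro g hg
    refine ⟨fun s ↦ if s = 0 then C (g.coeff 0) else 0, fun s ↦ ?_, fun L _ _ x y _ ↦ ?_⟩
    · dsimp only; split_ifs <;> simp
    · rw [eq_C_of_natDegree_le_zero hg, Finset.sum_eq_single 0] <;> simp +contextual
  | succ E ih =>
    intro g hg
    obtain ⟨c, hc, hcL⟩ := ih g.divX (by rw [natDegree_divX_eq_natDegree_tsub_one]; omega)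
    refine ⟨fun s ↦ if s = 0 then A * c (n + 1) + D ^ (E + 1) * C (g.coeff 0) else
      D * c (s - 1) + if s = 1 then D * c (n + 1) else 0, fun s ↦ ?_, fun L _ _ x y h ↦ ?_⟩
    · have key (f : K[X]) (hf : f.natDegree ≤ δ) (s) : (f * c s).natDegree ≤ (E + 1) * δ := by
        refine natDegree_mul_le.trans ?_
        have := hc s
        rw [add_mul, one_mul]
        omega
      dsimp only
      split_ifs with h1 h2
      · refine natDegree_add_le_of_degree_le (key A hA _) ?_
        exact natDegree_mul_C_le _ _ |>.trans (natDegree_pow_le.trans (Nat.mul_le_mul_left _ hD))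
      · exact natDegree_add_le_of_degree_le (key D hD _) (key D hD _)
      · rw [add_zero]; exact key D hD _
    · have h1 := hcL L x y h
      have h2 : aeval y g = y * aeval y g.divX + algebraMap K L (g.coeff 0) := by
        conv_lhs => rw [← divX_mul_X_add g]
        rw [map_add, map_mul, aeval_X, aeval_C, mul_comm]
      rw [h2, mul_add, show aeval x D ^ (E + 1) * (y * aeval y g.divX) =
        aeval x D * y * (aeval x D ^ E * aeval y g.divX) by ring, h1,
        Finset.sum_range_succ, Finset.sum_range_succ' _ (n + 1)]
      have h3 : ∑ k ∈ Finset.range (n + 1),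
          aeval x (D * c k + if k = 0 then D * c (n + 1) else 0) * y ^ (k + 1) =
          aeval x D * y * ∑ k ∈ Finset.range (n + 1), aeval x (c k) * y ^ k +
            aeval x D * aeval x (c (n + 1)) * y := by
        have h4 (k : ℕ) : aeval x (D * c k + if k = 0 then D * c (n + 1) else 0) * y ^ (k + 1) =
            aeval x D * y * (aeval x (c k) * y ^ k) +
              if k = 0 then aeval x D * aeval x (c (n + 1)) * y else 0 := by
          split_ifs with hk
          · subst hk; simp only [map_add, map_mul]; ring
          · simp only [map_add, map_mul, map_zero]; ring
        rw [Finset.sum_congr rfl fun k _ ↦ h4 k, Finset.sum_add_distrib, ← Finset.mul_sum]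
        simp
      simp only [Nat.add_sub_cancel, Nat.add_eq_zero_iff, one_ne_zero, and_false, if_false,
        Nat.add_eq_right, if_true]
      rw [h3]
      simp only [map_add, map_mul, map_pow, aeval_C]
      linear_combination aeval x (c (n + 1)) * h

theorem exists_nontrivial_relation {K ι : Type*} [Field K] [Fintype ι] {p B : ℕ}
    (F : ι → ℕ → K[X]) (hF : ∀ t s, (F t s).natDegree ≤ B) (hcard : p * (B + 1) < Fintype.card ι) :
    ∃ c : ι → K, c ≠ 0 ∧ ∀ s < p, ∑ t, C (c t) * F t s = 0 := by
  let f : (ι → K) →ₗ[K] (Fin p × Fin (B + 1) → K) :=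
    LinearMap.pi fun s ↦ ∑ t, ((F t s.1).coeff s.2) • LinearMap.proj t
  have hker : LinearMap.ker f ≠ ⊥ := by
    apply LinearMap.ker_ne_bot_of_finrank_lt
    simpa using hcard
  obtain ⟨c, hc, hc0⟩ := Submodule.exists_mem_ne_zero_of_ne_bot hker
  refine ⟨c, hc0, fun s hs ↦ ?_⟩
  ext i
  by_cases hi : i < B + 1
  · have := congrFun (LinearMap.mem_ker.mp hc) (⟨s, hs⟩, ⟨i, hi⟩)
    simpa [f, finsetSum_coeff, mul_comm] using this
  · rw [finsetSum_coeff, coeff_zero]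
    refine Finset.sum_eq_zero fun t _ ↦ ?_
    rw [coeff_C_mul, coeff_eq_zero_of_natDegree_lt (by have := hF t s; omega), mul_zero]

theorem stepanov_parameters {p δ μ ν : ℕ} (hp : 2 ≤ p) (hμ : 1 ≤ μ) (hμν : μ ≤ ν) :
    p * (p ^ μ * (p ^ (ν - 1) - 1) + (p ^ (μ - 1) + 2 * p * δ) + p * p ^ μ * δ + 1) <
      (p ^ (ν - 1) - 1 + 1) * ((p ^ (μ - 1) + 2 * p * δ + 1) * (p * p)) := by
  obtain ⟨a, rfl⟩ : ∃ a, μ = a + 1 := ⟨μ - 1, by omega⟩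
  obtain ⟨b, rfl⟩ : ∃ b, ν = b + 1 := ⟨ν - 1, by omega⟩
  simp only [Nat.add_sub_cancel]
  have hab : p ^ a ≤ p ^ b := Nat.pow_le_pow_right (by omega) (by omega)
  have ha : 1 ≤ p ^ a := Nat.one_le_pow _ _ (by omega)
  obtain ⟨u, hu⟩ : ∃ u, p ^ b = u + 1 := ⟨p ^ b - 1, by omega⟩
  obtain ⟨w, hw⟩ : ∃ w, u + 1 = p ^ a + w := ⟨u + 1 - p ^ a, by omega⟩
  rw [pow_succ, hu, Nat.add_sub_cancel]
  generalize p ^ a = R at *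
  obtain ⟨q, rfl⟩ : ∃ q, p = q + 2 := ⟨p - 2, by omega⟩
  obtain ⟨R', rfl⟩ : ∃ R', R = R' + 1 := ⟨R - 1, by omega⟩
  obtain rfl : u = R' + w := by omega
  have h : (R' + 1) * (q + 2) * (R' + w) + (R' + 1 + 2 * (q + 2) * δ) +
      (q + 2) * ((R' + 1) * (q + 2)) * δ + 1 <
      (R' + w + 1) * ((R' + 1 + 2 * (q + 2) * δ + 1) * (q + 2)) := by
    zify
    have : (0 : ℤ) ≤ R' ∧ (0 : ℤ) ≤ w ∧ (0 : ℤ) ≤ q ∧ (0 : ℤ) ≤ δ := by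
      refine ⟨?_, ?_, ?_, ?_⟩ <;> positivity
    obtain ⟨h1, h2, h3, h4⟩ := this
    rw [← sub_pos]
    ring_nf
    positivity
  nlinarith [h]

/-- Stepanov's method for Artin–Schreier curves, in the style of Bombieri: the number of `x` fixed by
the `p ^ (μ + ν)`-power Frobenius over which that Frobenius acts on the fibre of
`D(x) (y ^ p - y) = A(x)` as the translation by `γ`. -/
theorem stepanov_bound {K : Type} [Field K] [IsAlgClosed K] {p : ℕ} [Fact p.Prime] [CharP K p]
    {A D : K[X]} {δ : ℕ} (hA : A.natDegree ≤ δ) (hD : D.natDegree ≤ δ)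
    (hgen : (IsCoprime A D ∧ derivative D ≠ 0) ∨ (D = 1 ∧ ¬ p ∣ A.natDegree))
    {μ ν : ℕ} (hμ : 1 ≤ μ) (hμν : μ ≤ ν) (γ : K) (Z : Finset K)
    (hZ : ∀ x ∈ Z, x ^ (p ^ μ * p ^ ν) = x ∧ D.eval x ≠ 0 ∧
      ∃ y, D.eval x * (y ^ p - y) = A.eval x ∧ y ^ (p ^ μ * p ^ ν) = y + γ) :
    p * Z.card ≤ p ^ (μ + ν) + (3 * p ^ 2 * δ + 1) * p ^ ν := by
  classical
  have hp : p.Prime := Fact.out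
  obtain ⟨a, L, _, _, x, y, hDx, hxy, hind⟩ := exists_generic_point hp hgen
  set R := p ^ μ with hR
  set Q := p ^ ν with hQ
  have hRp : p ≤ R := Nat.le_self_pow (by omega) p
  have hQp : p ≤ Q := Nat.le_self_pow (by omega) p
  set l := p ^ (ν - 1) - 1 with hl
  set m := p ^ (μ - 1) + 2 * p * δ with hm
  have hlQ : p * l < Q := by
    rw [hl, hQ, show p ^ ν = p * p ^ (ν - 1) by rw [← pow_succ', Nat.sub_add_cancel (by omega)]]
    exact Nat.mul_lt_mul_of_pos_left (Nat.sub_lt (pow_pos hp.pos _) one_pos) hp.pos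
  set b := a ^ (R * Q)
  have hdeg1 (j k : Fin p) : (X ^ (j.val * R) * (X + C γ) ^ k.val : K[X]).natDegree ≤ p * R := by
    refine natDegree_mul_le.trans ?_
    rw [natDegree_X_pow, natDegree_pow, natDegree_X_add_C]
    have hj : (j.val + 1) * R ≤ p * R := Nat.mul_le_mul_right _ j.2
    have := k.2
    linarith
  have hdeg2 (j k : Fin p) : (X ^ (j.val + k.val * Q) : K[X]).natDegree ≤ p * Q := by
    rw [natDegree_X_pow]
    have hk : (k.val + 1) * Q ≤ p * Q := Nat.mul_le_mul_right _ k.2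
    have := j.2
    linarith
  choose c₁ hc₁ hc₁L using fun j k ↦ exists_reduction hp.one_lt hA hD _ _ (hdeg1 j k)
  choose c₂ hc₂ hc₂L using fun j k ↦ exists_reduction hp.one_lt hA hD _ _ (hdeg2 j k)
  obtain ⟨c', hc'0, hc'⟩ := exists_nontrivial_relation
    (ι := Fin (l + 1) × Fin (m + 1) × Fin p × Fin p) (p := p) (B := R * l + m + p * R * δ)
    (fun t s ↦ (X - C a) ^ (R * t.1.val) * (X - C b) ^ t.2.1.val * c₁ t.2.2.1 t.2.2.2 s)
    (fun t s ↦ by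
      refine natDegree_mul_le.trans (add_le_add (natDegree_mul_le.trans (add_le_add ?_ ?_))
        (hc₁ _ _ _))
      · rw [natDegree_pow, natDegree_X_sub_C, mul_one]
        exact Nat.mul_le_mul_left _ (Nat.lt_succ_iff.mp t.1.2)
      · rw [natDegree_pow, natDegree_X_sub_C, mul_one]
        exact Nat.lt_succ_iff.mp t.2.1.2)
    (by
      simp only [Fintype.card_prod, Fintype.card_fin]
      exact stepanov_parameters hp.two_le hμ hμν)
  choose c hc using fun t ↦ IsAlgClosed.exists_pow_nat_eq (c' t) (pow_pos hp.pos μ)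
  have hc0 : c ≠ 0 := by
    rintro rfl
    apply hc'0
    ext t
    rw [← hc t]
    exact zero_pow (pow_pos hp.pos μ).ne'
  set G : ℕ → K[X] := fun s ↦ ∑ t : Fin (l + 1) × Fin (m + 1) × Fin p × Fin p,
    C (c t) * (X - C a) ^ (t.1.val + t.2.1.val * Q) * c₂ t.2.2.1 t.2.2.2 s with hG
  have hGdeg (s : ℕ) : (G s).natDegree ≤ l + m * Q + p * Q * δ := by
    refine natDegree_sum_le_of_forall_le _ _ fun t _ ↦ natDegree_mul_le.trans (add_le_add ?_
      (hc₂ _ _ _))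
    refine (natDegree_C_mul_le _ _).trans ?_
    rw [natDegree_pow, natDegree_X_sub_C, mul_one]
    exact add_le_add (Nat.lt_succ_iff.mp t.1.2)
      (Nat.mul_le_mul_right _ (Nat.lt_succ_iff.mp t.2.1.2))
  have hGeval (L : Type) [Field L] [Algebra K L] (x y : L)
      (h : aeval x D * (y ^ p - y) = aeval x A) :
      aeval x D ^ (p * Q) * ∑ t : Fin (l + 1) × Fin (m + 1) × Fin p × Fin p,
        algebraMap K L (c t) * ((x - algebraMap K L a) ^ (t.1.val + t.2.1.val * Q) *
          y ^ (t.2.2.1.val + t.2.2.2.val * Q)) =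
      ∑ s ∈ Finset.range p, aeval x (G s) * y ^ s := by
    simp only [hG, map_sum, Finset.sum_mul, Finset.mul_sum]
    rw [Finset.sum_comm]
    refine Finset.sum_congr rfl fun t _ ↦ ?_
    have h1 := hc₂L t.2.2.1 t.2.2.2 L x y h
    rw [map_pow, aeval_X] at h1
    simp only [map_mul, map_pow, map_sub, aeval_C, aeval_X]
    rw [show ∀ u v w z : L, u * (v * (w * z)) = v * w * (u * z) from fun _ _ _ _ ↦ by ring, h1,
      Finset.mul_sum]
    exact Finset.sum_congr rfl fun s _ ↦ by ring
  obtain ⟨s, hs, hGs⟩ : ∃ s < p, G s ≠ 0 := by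
    by_contra! hall
    have h1 := hGeval L x y hxy
    have h2 : ∑ s ∈ Finset.range p, aeval x (G s) * y ^ s = 0 :=
      Finset.sum_eq_zero fun s hs ↦ by rw [hall s (Finset.mem_range.mp hs), map_zero, zero_mul]
    rw [h2, mul_eq_zero] at h1
    rcases h1 with h1 | h1
    · exact pow_ne_zero _ hDx h1
    · exact hind l m Q (dvd_pow_self p (by omega)) hlQ c hc0 h1
  have hvanish (x₀ : K) (hx₀ : x₀ ∈ Z) (y₁ : K) (hy₁ : D.eval x₀ * (y₁ ^ p - y₁) = A.eval x₀)
      (hy₁' : y₁ ^ (R * Q) = y₁ + γ) :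
      ∑ s ∈ Finset.range p, (G s).eval x₀ * y₁ ^ s = 0 := by
    obtain ⟨hxQ, hDx₀, -⟩ := hZ x₀ hx₀
    have h1 := hGeval K x₀ y₁ (by simpa [coe_aeval_eq_eval] using hy₁)
    simp only [coe_aeval_eq_eval] at h1
    rw [← h1]
    refine mul_eq_zero_of_right _ (eq_zero_of_pow_eq_zero (n := R) ?_)
    refine (mul_eq_zero.mp ?_).resolve_left (pow_ne_zero (p * R) hDx₀)
    rw [hR, sum_pow_char_pow, ← hR, Finset.mul_sum]
    have hterm (t : Fin (l + 1) × Fin (m + 1) × Fin p × Fin p) :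
        D.eval x₀ ^ (p * R) * (algebraMap K K (c t) * ((x₀ - algebraMap K K a) ^
          (t.1.val + t.2.1.val * Q) * y₁ ^ (t.2.2.1.val + t.2.2.2.val * Q))) ^ R =
        ∑ s ∈ Finset.range p, eval x₀ (C (c' t) * ((X - C a) ^ (R * t.1.val) *
          (X - C b) ^ t.2.1.val * c₁ t.2.2.1 t.2.2.2 s)) * y₁ ^ s := by
      have h2 := hc₁L t.2.2.1 t.2.2.2 K x₀ y₁ (by simpa [coe_aeval_eq_eval] using hy₁)
      simp only [coe_aeval_eq_eval, eval_mul, eval_pow, eval_X, eval_add, eval_C] at h2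
      have hxb : ((x₀ - a) ^ Q) ^ R = x₀ - b := by
        rw [← pow_mul, mul_comm Q R, hR, hQ, ← pow_add, sub_pow_char_pow, pow_add, ← hR, ← hQ, hxQ]
      have h3 : (algebraMap K K (c t) * ((x₀ - algebraMap K K a) ^
          (t.1.val + t.2.1.val * Q) * y₁ ^ (t.2.2.1.val + t.2.2.2.val * Q))) ^ R =
          c' t * ((x₀ - a) ^ (R * t.1.val) * (x₀ - b) ^ t.2.1.val) *
            (y₁ ^ (t.2.2.1.val * R) * (y₁ + γ) ^ t.2.2.2.val) := by
        rw [← hc t, ← hR, ← hxb, ← hy₁', Algebra.algebraMap_self_apply,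
          Algebra.algebraMap_self_apply]
        ring
      rw [h3, show ∀ u v w : K, u * (v * w) = v * (u * w) from fun _ _ _ ↦ by ring, h2,
        Finset.mul_sum]
      refine Finset.sum_congr rfl fun s _ ↦ ?_
      simp only [eval_mul, eval_pow, eval_X, eval_sub, eval_C]
      ring
    rw [Finset.sum_congr rfl fun t _ ↦ hterm t, Finset.sum_comm]
    refine Finset.sum_eq_zero fun s hs ↦ ?_
    rw [← Finset.sum_mul, ← eval_finsetSum, hc' s (Finset.mem_range.mp hs), eval_zero, zero_mul]
  have hroot (x₀ : K) (hx₀ : x₀ ∈ Z) : (G s).IsRoot x₀ := by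
    obtain ⟨hxQ, hDx₀, y₀, hy₀, hy₀'⟩ := hZ x₀ hx₀
    set f : K[X] := ∑ s ∈ Finset.range p, C ((G s).eval x₀) * X ^ s with hf
    have hcoeff : f.coeff s = (G s).eval x₀ := by
      simp [hf, finsetSum_coeff, coeff_X_pow, hs]
    rw [IsRoot, ← hcoeff]
    have hf0 : f = 0 := by
      refine eq_zero_of_natDegree_lt_card_of_eval_eq_zero f
        (f := fun z : ZMod p ↦ y₀ + ZMod.castHom dvd_rfl K z)
        (fun z w h ↦ (ZMod.castHom dvd_rfl K).injective (add_left_cancel h)) ?_ ?_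
      · intro z
        have hz (n : ℕ) : (ZMod.castHom dvd_rfl K z) ^ p ^ n = ZMod.castHom dvd_rfl K z := by
          rw [← map_pow, ZMod.pow_card_pow]
        have h1 := hvanish x₀ hx₀ (y₀ + ZMod.castHom dvd_rfl K z) (by
          have := hz 1
          rw [pow_one] at this
          rw [add_pow_char, this, add_sub_add_right_eq_sub, hy₀]) (by
          rw [hR, hQ, ← pow_add, add_pow_char_pow, hz, pow_add, ← hR, ← hQ, hy₀']
          ring)
        simpa [hf, eval_finsetSum] using h1
      · rw [ZMod.card]
        refine (natDegree_sum_le_of_forall_le (n := p - 1) _ _ fun s hs ↦ ?_).trans_lt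
          (Nat.sub_lt hp.pos one_pos)
        exact (natDegree_C_mul_X_pow_le _ _).trans (Nat.le_sub_one_of_lt (Finset.mem_range.mp hs))
    rw [hf0, coeff_zero]
  have hcard : Z.card ≤ l + m * Q + p * Q * δ := by
    refine le_trans ?_ (hGdeg s)
    exact Polynomial.card_le_degree_of_subset_roots (p := G s) fun x₀ hx₀ ↦
      (mem_roots hGs).mpr (hroot x₀ hx₀)
  calc p * Z.card ≤ p * (l + m * Q + p * Q * δ) := Nat.mul_le_mul_left _ hcard
    _ = p * l + (p * p ^ (μ - 1) + 2 * p ^ 2 * δ) * Q + p ^ 2 * δ * Q := by rw [hm]; ring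
    _ ≤ Q + (R + 2 * p ^ 2 * δ) * Q + p ^ 2 * δ * Q := by
      rw [← pow_succ', Nat.sub_add_cancel hμ]
      gcongr
    _ = p ^ (μ + ν) + (3 * p ^ 2 * δ + 1) * p ^ ν := by rw [pow_add, ← hR, ← hQ]; ring

theorem Polynomial.exists_eq_pow_of_derivative_eq_zero {F : Type*} [Field F] {p : ℕ}
    [Fact p.Prime] [CharP F p] [PerfectRing F p] {D : F[X]} (h : derivative D = 0) :
    ∃ G : F[X], D = G ^ p := by
  have hp : p ≠ 0 := (Fact.out : p.Prime).ne_zero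
  have h1 := expand_contract p h hp
  obtain ⟨G, hG⟩ := Polynomial.map_surjective (frobenius F p)
    (surjective_frobenius F p) (contract p D)
  refine ⟨G, ?_⟩
  rw [← h1, ← hG, ← map_expand, map_frobenius_expand]

theorem Polynomial.exists_artinSchreier_natDegree_lt {F : Type*} [Field F] {p : ℕ}
    [Fact p.Prime] [CharP F p] [PerfectRing F p] {A : F[X]} (hA : 0 < A.natDegree)
    (hpA : p ∣ A.natDegree) :
    ∃ B : F[X], (A - (B ^ p - B)).natDegree < A.natDegree := by
  have hp : p.Prime := Fact.out
  obtain ⟨m, hm⟩ := hpA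
  have hm0 : 0 < m := Nat.pos_of_ne_zero fun h => by simp [hm, h] at hA
  obtain ⟨b, hb⟩ := surjective_frobenius F p A.leadingCoeff
  rw [frobenius_def] at hb
  have hA0 : A ≠ 0 := fun h => by simp [h] at hA
  have hb0 : b ≠ 0 := fun h => by
    rw [h, zero_pow hp.ne_zero] at hb
    exact hA0 (leadingCoeff_eq_zero.mp hb.symm)
  refine ⟨C b * X ^ m, ?_⟩
  have hpow : (C b * X ^ m : F[X]) ^ p = C A.leadingCoeff * X ^ A.natDegree := by
    rw [mul_pow, ← C_pow, hb, ← pow_mul, hm, mul_comm m]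
  have h1 : (A - C A.leadingCoeff * X ^ A.natDegree).degree < A.degree := by
    apply degree_sub_lt_left _ hA0 _
    · rw [degree_C_mul_X_pow _ (leadingCoeff_ne_zero.mpr hA0), degree_eq_natDegree hA0]
    · simp
  have h2 : (C b * X ^ m : F[X]).degree < A.degree := by
    rw [degree_C_mul_X_pow _ hb0, degree_eq_natDegree hA0, hm]
    exact_mod_cast lt_mul_of_one_lt_left hm0 hp.one_lt
  have h3 : (A - ((C b * X ^ m) ^ p - C b * X ^ m)).degree < A.degree := by
    rw [hpow, ← sub_add]
    exact (degree_add_le _ _).trans_lt (max_lt h1 h2)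
  by_cases h0 : A - ((C b * X ^ m) ^ p - C b * X ^ m) = 0
  · rwa [h0, natDegree_zero]
  · exact natDegree_lt_natDegree h0 h3

theorem Polynomial.exists_dvd_sub_pow {F : Type*} [Field F] [Finite F] {p : ℕ}
    [Fact p.Prime] [CharP F p] {P : F[X]} (hP : Irreducible P) (A : F[X]) :
    ∃ B : F[X], P ∣ A - B ^ p := by
  have : Fact (Irreducible P) := ⟨hP⟩
  have : Module.Finite F (AdjoinRoot P) :=
    (AdjoinRoot.powerBasis hP.ne_zero).finite
  have : Finite (AdjoinRoot P) := Module.finite_of_finite F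
  have : CharP (AdjoinRoot P) p := charP_of_injective_algebraMap (algebraMap F _).injective p
  obtain ⟨b, hb⟩ := surjective_frobenius (AdjoinRoot P) p (AdjoinRoot.mk P A)
  obtain ⟨B, rfl⟩ := AdjoinRoot.mk_surjective b
  refine ⟨B, ?_⟩
  rw [← AdjoinRoot.mk_eq_mk, map_pow, ← hb, frobenius_def]

theorem RatFunc.exists_artinSchreier_natDegree_denom_lt {F : Type*} [Field F] [Finite F] {p : ℕ}
    [Fact p.Prime] [CharP F p] {n : RatFunc F} (hn : derivative n.denom = 0)
    (hn1 : n.denom ≠ 1) :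
    ∃ h : RatFunc F, (n - (h ^ p - h)).denom.natDegree < n.denom.natDegree := by
  have hp : p.Prime := Fact.out
  obtain ⟨G, hG⟩ := exists_eq_pow_of_derivative_eq_zero (p := p) hn
  have hG0 : G ≠ 0 := fun h => n.denom_ne_zero (by rw [hG, h, zero_pow hp.ne_zero])
  have hGu : ¬ IsUnit G := fun h => hn1 <| by
    have : IsUnit n.denom := hG ▸ h.pow p
    exact n.monic_denom.isUnit_iff.mp this
  obtain ⟨P, hP, G1, rfl⟩ := WfDvdMonoid.exists_irreducible_factor hGu hG0
  obtain ⟨B, A1, hB⟩ := exists_dvd_sub_pow (p := p) hP n.num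
  have hP0 : P ≠ 0 := hP.ne_zero
  have hG10 : G1 ≠ 0 := right_ne_zero_of_mul hG0
  obtain ⟨r, hr⟩ : ∃ r, p = r + 2 := Nat.exists_eq_add_of_le' hp.two_le
  have hQ0 : P ^ (p - 1) * G1 ^ p ≠ 0 := mul_ne_zero (pow_ne_zero _ hP0) (pow_ne_zero _ hG10)
  refine ⟨algebraMap _ _ B / algebraMap _ _ (P * G1), ?_⟩
  have key : (n - ((algebraMap F[X] (RatFunc F) B / algebraMap _ _ (P * G1)) ^ p -
      algebraMap F[X] (RatFunc F) B / algebraMap _ _ (P * G1))) =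
      algebraMap _ _ (A1 + B * P ^ (p - 2) * G1 ^ (p - 1)) /
        algebraMap _ _ (P ^ (p - 1) * G1 ^ p) := by
    have hn2 := RatFunc.num_div_denom n
    rw [hG, sub_eq_iff_eq_add.mp hB] at hn2
    rw [← hn2]
    have h1 : algebraMap F[X] (RatFunc F) P ≠ 0 := by simpa using hP0
    have h2 : algebraMap F[X] (RatFunc F) G1 ≠ 0 := by simpa using hG10
    clear hn2 hB hG
    subst hr
    simp only [map_mul, map_add, map_pow, Nat.add_sub_cancel, show r + 2 - 1 = r + 1 by omega]
    generalize algebraMap F[X] (RatFunc F) P = x at *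
    generalize algebraMap F[X] (RatFunc F) G1 = y at *
    rw [div_pow]
    field_simp
    ring
  rw [key]
  refine (natDegree_le_of_dvd (RatFunc.denom_div_dvd _ _) hQ0).trans_lt ?_
  rw [hG, mul_pow, natDegree_mul (pow_ne_zero _ hP0) (pow_ne_zero _ hG10),
    natDegree_mul (pow_ne_zero _ hP0) (pow_ne_zero _ hG10), natDegree_pow, natDegree_pow]
  have := hP.natDegree_pos
  have h3 : p - 1 < p := by omega
  rw [natDegree_pow]
  gcongr

theorem RatFunc.exists_artinSchreier_reduced {F : Type*} [Field F] [Finite F] (p : ℕ)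
    [Fact p.Prime] [CharP F p] (n : RatFunc F) :
    ∃ h n' : RatFunc F, n = n' + (h ^ p - h) ∧
      (derivative n'.denom ≠ 0 ∨ (n'.denom = 1 ∧ ¬ p ∣ n'.num.natDegree) ∨
        ∃ c : F, n' = algebraMap F _ c) := by
  have poly : ∀ (d : ℕ) (A : F[X]), A.natDegree = d → ∃ h n' : RatFunc F,
      algebraMap F[X] _ A = n' + (h ^ p - h) ∧ ((n'.denom = 1 ∧ ¬ p ∣ n'.num.natDegree) ∨
        ∃ c : F, n' = algebraMap F _ c) := by
    intro d
    induction d using Nat.strong_induction_on with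
    | _ d ih =>
      intro A hA
      by_cases hd : d = 0
      · rw [hd, natDegree_eq_zero] at hA
        obtain ⟨c, rfl⟩ := hA
        exact ⟨0, algebraMap F[X] _ (Polynomial.C c), by simp [(Fact.out : p.Prime).ne_zero],
          Or.inr ⟨c, by simp⟩⟩
      by_cases hpd : p ∣ d
      · obtain ⟨B, hB⟩ := exists_artinSchreier_natDegree_lt (by omega) (hA ▸ hpd)
        obtain ⟨h, n', hn', hred⟩ := ih _ (hA ▸ hB) _ rfl
        refine ⟨h + algebraMap F[X] _ B, n', ?_, hred⟩
        rw [map_sub, map_sub, map_pow, sub_eq_iff_eq_add] at hn'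
        have : CharP (RatFunc F) p := charP_of_injective_algebraMap (algebraMap F _).injective p
        rw [hn', add_pow_char]
        ring
      · exact ⟨0, algebraMap F[X] _ A, by simp [(Fact.out : p.Prime).ne_zero],
          Or.inl ⟨by simp, by simpa [hA] using hpd⟩⟩
  suffices H : ∀ (d : ℕ) (n : RatFunc F), n.denom.natDegree = d →
      ∃ h n' : RatFunc F, n = n' + (h ^ p - h) ∧
      (derivative n'.denom ≠ 0 ∨ (n'.denom = 1 ∧ ¬ p ∣ n'.num.natDegree) ∨
        ∃ c : F, n' = algebraMap F _ c) from H _ n rfl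
  intro d
  induction d using Nat.strong_induction_on with
  | _ d ih =>
    intro n hd
    by_cases hder : derivative n.denom = 0
    swap
    · exact ⟨0, n, by simp [(Fact.out : p.Prime).ne_zero], Or.inl hder⟩
    by_cases h1 : n.denom = 1
    · obtain ⟨h, n', hn', hred⟩ := poly _ n.num rfl
      refine ⟨h, n', ?_, Or.inr hred⟩
      rw [← hn']
      conv_lhs => rw [← RatFunc.num_div_denom n, h1, map_one, div_one]
    · obtain ⟨g, hg⟩ := exists_artinSchreier_natDegree_denom_lt hder h1
      obtain ⟨h, n', hn', hred⟩ := ih _ (hd ▸ hg) _ rfl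
      refine ⟨h + g, n', ?_, hred⟩
      rw [sub_eq_iff_eq_add] at hn'
      have : CharP (RatFunc F) p := charP_of_injective_algebraMap (algebraMap F _).injective p
      rw [hn', add_pow_char]
      ring

theorem RatFunc.exists_artinSchreier_reduced_of_geometric {F : Type*} [Field F] [Finite F]
    {p : ℕ} [Fact p.Prime] [CharP F p] {n : RatFunc F} {E : Type*} [Field E]
    [Algebra (RatFunc F) E] [Algebra F E] [IsScalarTower F (RatFunc F) E] {α : E}
    (hα : α ^ p - α = algebraMap (RatFunc F) E n)
    (hgen : Algebra.adjoin (RatFunc F) ({α} : Set E) = ⊤)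
    (hdeg : Module.finrank (RatFunc F) E = p)
    (hgeo : ∀ x : E, IsAlgebraic F x → ∃ c : F, algebraMap F E c = x) :
    ∃ h n' : RatFunc F, n = n' + (h ^ p - h) ∧
      (derivative n'.denom ≠ 0 ∨ (n'.denom = 1 ∧ ¬ p ∣ n'.num.natDegree)) := by
  have hp : p.Prime := Fact.out
  obtain ⟨h, n', hn, h1 | h2 | ⟨c, rfl⟩⟩ := exists_artinSchreier_reduced p n
  · exact ⟨h, n', hn, Or.inl h1⟩
  · exact ⟨h, n', hn, Or.inr h2⟩
  exfalso
  have : CharP E p := charP_of_injective_algebraMap (algebraMap F E).injective p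
  have hβ : (α - algebraMap _ E h) ^ p - (α - algebraMap _ E h) = algebraMap F E c := by
    rw [hn, map_add, map_sub, map_pow, ← IsScalarTower.algebraMap_apply] at hα
    rw [sub_pow_char]
    linear_combination hα
  obtain ⟨b, hb⟩ := hgeo (α - algebraMap _ E h) <| by
    refine ⟨(Polynomial.X ^ p - (Polynomial.X + Polynomial.C c) : Polynomial F), fun h0 => ?_, ?_⟩
    · have := (monic_X_pow_sub (p := (Polynomial.X + Polynomial.C c : Polynomial F)) (n := p) (by
        rw [Polynomial.degree_X_add_C]; exact_mod_cast hp.one_lt)).ne_zero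
      exact this h0
    · simp only [map_sub, map_add, map_pow, Polynomial.aeval_X, Polynomial.aeval_C]
      linear_combination hβ
  have hmem : α ∈ (⊥ : Subalgebra (RatFunc F) E) := by
    rw [Algebra.mem_bot]
    refine ⟨algebraMap F _ b + h, ?_⟩
    rw [map_add, ← IsScalarTower.algebraMap_apply, hb, sub_add_cancel]
  have htop : (⊥ : Subalgebra (RatFunc F) E) = ⊤ := by
    rw [← hgen, eq_comm, ← le_bot_iff]
    exact Algebra.adjoin_le (Set.singleton_subset_iff.mpr hmem)
  have := Subalgebra.bot_eq_top_iff_finrank_eq_one.mp htop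
  exact hp.one_lt.ne (by rw [← hdeg, this])

theorem FiniteField.aeval_pow_card_pow {F K : Type*} [Field F] [Finite F] [Field K] [Algebra F K]
    (f : F[X]) (x : K) (N : ℕ) :
    aeval x f ^ Nat.card F ^ N = aeval (x ^ Nat.card F ^ N) f := by
  have := Fintype.ofFinite F
  rw [← Fintype.card_eq_nat_card]
  induction N with
  | zero => simp
  | succ k ih =>
    rw [pow_succ, pow_mul, ih, pow_mul]
    exact (Polynomial.aeval_algHom_apply (FiniteField.frobeniusAlgHom F K) _ f).symm

theorem exists_artinSchreier_fiber_bound {F K : Type} [Field F] [Finite F] [Field K]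
    [IsAlgClosed K] [Algebra F K] {p : ℕ} [Fact p.Prime] [CharP F p] {n n' h : RatFunc F}
    (hn : n = n' + (h ^ p - h))
    (hn' : derivative n'.denom ≠ 0 ∨ (n'.denom = 1 ∧ ¬ p ∣ n'.num.natDegree)) :
    ∃ C : ℕ, ∀ μ ν N : ℕ, 1 ≤ μ → μ ≤ ν → Nat.card F ^ N = p ^ (μ + ν) →
      ∀ (γ : K) (Z : Finset K), (∀ x ∈ Z, x ^ Nat.card F ^ N = x ∧ aeval x n.denom ≠ 0 ∧
        ∃ y, aeval x n.denom * (y ^ p - y) = aeval x n.num ∧ y ^ Nat.card F ^ N = y + γ) →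
      p * Z.card ≤ Nat.card F ^ N + C * p ^ ν := by
  classical
  have hp : p.Prime := Fact.out
  have : CharP K p := charP_of_injective_algebraMap (algebraMap F K).injective p
  set δ := max n'.num.natDegree n'.denom.natDegree with hδ
  have hid : n.num * (n'.denom * h.denom ^ p) =
      n.denom * (n'.num * h.denom ^ p + n'.denom * (h.num ^ p - h.num * h.denom ^ (p - 1))) := by
    apply RatFunc.algebraMap_injective F
    have e1 := RatFunc.num_div_denom n
    have e2 := RatFunc.num_div_denom n'
    have e3 := RatFunc.num_div_denom h
    have d1 := RatFunc.algebraMap_ne_zero n.denom_ne_zero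
    have d2 := RatFunc.algebraMap_ne_zero n'.denom_ne_zero
    have d3 := RatFunc.algebraMap_ne_zero h.denom_ne_zero
    rw [← e1, ← e2, ← e3] at hn
    simp only [map_mul, map_add, map_sub, map_pow]
    simp only [RatFunc.num_div_denom] at hn
    rw [← e1, ← e2, ← e3] at hn
    obtain ⟨r, rfl⟩ : ∃ r, p = r + 1 := Nat.exists_eq_add_of_le' hp.one_le
    rw [div_pow] at hn
    rw [Nat.add_sub_cancel]
    generalize algebraMap F[X] (RatFunc F) n.denom = a at *
    generalize algebraMap F[X] (RatFunc F) n'.denom = b at *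
    generalize algebraMap F[X] (RatFunc F) h.denom = c at *
    generalize algebraMap F[X] (RatFunc F) n.num = a' at *
    generalize algebraMap F[X] (RatFunc F) n'.num = b' at *
    generalize algebraMap F[X] (RatFunc F) h.num = c' at *
    rw [div_eq_iff d1] at hn
    rw [hn]
    field_simp
    ring
  set bad : Finset K := ((n'.denom * h.denom).map (algebraMap F K)).roots.toFinset with hbad
  have hbad0 : (n'.denom * h.denom).map (algebraMap F K) ≠ 0 :=
    Polynomial.map_ne_zero (mul_ne_zero n'.denom_ne_zero h.denom_ne_zero)
  refine ⟨3 * p ^ 2 * δ + 1 + p * bad.card, fun μ ν N hμ hμν hN γ Z hZ => ?_⟩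
  have hmain : p * (Z \ bad).card ≤ p ^ (μ + ν) + (3 * p ^ 2 * δ + 1) * p ^ ν := by
    refine stepanov_bound (A := n'.num.map (algebraMap F K)) (D := n'.denom.map (algebraMap F K))
      (by rw [natDegree_map]; exact le_max_left _ _) (by rw [natDegree_map]; exact le_max_right _ _)
      ?_ hμ hμν γ (Z \ bad) fun x hx => ?_
    · rcases hn' with h1 | ⟨h1, h2⟩
      · refine Or.inl ⟨n'.isCoprime_num_denom.map (mapRingHom (algebraMap F K)), ?_⟩
        rw [derivative_map]
        exact Polynomial.map_ne_zero h1
      · exact Or.inr ⟨by rw [h1, Polynomial.map_one], by rwa [natDegree_map]⟩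
    · rw [Finset.mem_sdiff, hbad, Multiset.mem_toFinset, mem_roots hbad0, IsRoot.def,
        eval_map_algebraMap, map_mul, mul_eq_zero, not_or] at hx
      obtain ⟨hxZ, hx1, hx2⟩ := hx
      obtain ⟨hxQ, hx0, y, hy1, hy2⟩ := hZ x hxZ
      rw [← pow_add, ← hN]
      simp only [eval_map_algebraMap]
      refine ⟨hxQ, hx1, y - aeval x h.num / aeval x h.denom, ?_, ?_⟩
      · have := congrArg (aeval x) hid
        simp only [map_mul, map_add, map_sub, map_pow] at this
        rw [← hy1, mul_assoc, mul_right_inj' hx0] at this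
        rw [sub_pow_char, div_pow]
        obtain ⟨r, rfl⟩ : ∃ r, p = r + 1 := Nat.exists_eq_add_of_le' hp.one_le
        rw [Nat.add_sub_cancel] at this
        generalize aeval x n'.denom = b at *
        generalize aeval x h.denom = c at *
        field_simp
        linear_combination c * this
      · rw [hN, sub_pow_char_pow, ← hN, hy2, div_pow, FiniteField.aeval_pow_card_pow,
          FiniteField.aeval_pow_card_pow, hxQ]
        ring
  have hcard : Z.card ≤ (Z \ bad).card + bad.card := by
    have := Finset.le_card_sdiff bad Z
    omega
  have hν : 1 ≤ p ^ ν := Nat.one_le_pow _ _ hp.pos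
  calc p * Z.card ≤ p * (Z \ bad).card + p * bad.card * 1 := by
        rw [mul_one, ← mul_add]; gcongr
    _ ≤ p ^ (μ + ν) + (3 * p ^ 2 * δ + 1) * p ^ ν + p * bad.card * p ^ ν := by gcongr
    _ = _ := by rw [hN]; ring

theorem artinSchreier_iterate {K : Type*} [CommRing K] {p : ℕ} [Fact p.Prime] [CharP K p]
    {y z : K} (h : y ^ p - y = z) (m : ℕ) :
    y ^ p ^ m = y + ∑ i ∈ Finset.range m, z ^ p ^ i := by
  induction m with
  | zero => simp
  | succ m ih =>
    rw [pow_succ', pow_mul, sub_eq_iff_eq_add'.mp h, add_pow_char_pow, ih,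
      Finset.sum_range_succ, add_assoc]

theorem pow_card_pow_eq_add_hasseSymbol {p : ℕ} [Fact p.Prime] {F K : Type} [Field F] [Fintype F]
    [Algebra (ZMod p) F] [Field K] [Algebra F K] [CharP K p] {P : F[X]} (hP : Irreducible P)
    {n : RatFunc F} (hPn : ¬ P ∣ n.denom) {x y : K} (hx : aeval x P = 0)
    (hy : aeval x n.denom * (y ^ p - y) = aeval x n.num) :
    y ^ Nat.card F ^ P.natDegree = y + ZMod.castHom (dvd_refl p) K (hasseSymbol p P n) := by
  have : Fact (Irreducible P) := ⟨hP⟩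
  have : Module.Finite F (AdjoinRoot P) := (AdjoinRoot.powerBasis hP.ne_zero).finite
  have : Finite (AdjoinRoot P) := Module.finite_of_finite F
  let φ : AdjoinRoot P →+* K := AdjoinRoot.lift (algebraMap F K) x hx
  have hφ (f : F[X]) : φ (AdjoinRoot.mk P f) = aeval x f := AdjoinRoot.lift_mk _ _
  have hden : AdjoinRoot.mk P n.denom ≠ 0 := by rwa [Ne, AdjoinRoot.mk_eq_zero]
  have hden' : aeval x n.denom ≠ 0 := by
    rw [← hφ]; exact (map_ne_zero φ).mpr hden
  set w : AdjoinRoot P := AdjoinRoot.mk P n.num * Ring.inverse (AdjoinRoot.mk P n.denom) with hw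
  have hz : y ^ p - y = φ w := by
    rw [hw, map_mul, Ring.inverse_eq_inv', map_inv₀, hφ, hφ, ← hy]
    field_simp
  have hfin : Module.finrank F (AdjoinRoot P) = P.natDegree := by
    rw [(AdjoinRoot.powerBasis hP.ne_zero).finrank, AdjoinRoot.powerBasis_dim]
  have : Module.Finite (ZMod p) F := Module.Finite.of_finite
  have hcard : Nat.card F ^ P.natDegree = p ^ Module.finrank (ZMod p) (AdjoinRoot P) := by
    rw [← Module.finrank_mul_finrank (ZMod p) F (AdjoinRoot P), hfin, pow_mul,
      Module.natCard_eq_pow_finrank (K := ZMod p) (V := F), Nat.card_zmod]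
  have htr := FiniteField.algebraMap_trace_eq_sum_pow (ZMod p) (AdjoinRoot P) w
  rw [hcard, artinSchreier_iterate hz, hasseSymbol, Algebra.trace_trace]
  have hcast : ZMod.castHom (dvd_refl p) K = φ.comp (algebraMap (ZMod p) (AdjoinRoot P)) :=
    Subsingleton.elim _ _
  rw [hcast, RingHom.comp_apply, htr, map_sum]
  simp

/-- The points of `K` fixed by the `N`-th power of the Frobenius of `F`. -/
noncomputable def frobeniusFixed (F K : Type*) [Field F] [Field K] (N : ℕ) : Finset K := by
  classical exact (X ^ Nat.card F ^ N - X : K[X]).roots.toFinset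

/-- The monic irreducible polynomials of degree `N` over a finite field, as a finite set. -/
noncomputable def monicIrreducibles (F : Type*) [Field F] (N : ℕ) : Finset F[X] := by
  classical exact {P ∈ (frobeniusFixed F (AlgebraicClosure F) N).image (minpoly F) |
    P.natDegree = N}

theorem mem_frobeniusFixed {F K : Type*} [Field F] [Finite F] [Field K] {N : ℕ} (hN : N ≠ 0) {x : K} :
    x ∈ frobeniusFixed F K N ↔ x ^ Nat.card F ^ N = x := by
  have h := FiniteField.X_pow_card_pow_sub_X_ne_zero K hN (Finite.one_lt_card (α := F))
  simp [frobeniusFixed, mem_roots h, sub_eq_zero]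

theorem card_frobeniusFixed_le {F K : Type*} [Field F] [Finite F] [Field K] {N : ℕ}
    (hN : N ≠ 0) :
    (frobeniusFixed F K N).card ≤ Nat.card F ^ N := by
  classical
  exact (Multiset.toFinset_card_le _).trans ((card_roots' _).trans_eq
    (FiniteField.X_pow_card_pow_sub_X_natDegree_eq K hN Finite.one_lt_card))

theorem card_frobeniusFixed {F K : Type*} [Field F] [Finite F] [Field K] [IsAlgClosed K]
    [Algebra F K] {N : ℕ} (hN : N ≠ 0) :
    (frobeniusFixed F K N).card = Nat.card F ^ N := by
  classical
  obtain ⟨p, hp⟩ := CharP.exists F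
  have hprime : p.Prime := CharP.char_is_prime F p
  have : Fact p.Prime := ⟨hprime⟩
  have : CharP K p := charP_of_injective_algebraMap (algebraMap F K).injective p
  have hdvd : p ∣ Nat.card F ^ N := by
    have := Fintype.ofFinite F
    obtain ⟨m, _, hm⟩ := FiniteField.card F p
    rw [← Fintype.card_eq_nat_card, hm, ← pow_mul]
    exact dvd_pow_self p (mul_ne_zero m.ne_zero hN)
  rw [frobeniusFixed, Multiset.toFinset_card_of_nodup
    (nodup_roots (galois_poly_separable p _ hdvd)),
    ← (IsAlgClosed.splits _).natDegree_eq_card_roots,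
    FiniteField.X_pow_card_pow_sub_X_natDegree_eq K hN (Finite.one_lt_card (α := F))]

theorem minpoly_dvd_X_pow_sub_X {F K : Type*} [Field F] [Field K] [Algebra F K] {N : ℕ}
    {x : K} (hx : x ^ Nat.card F ^ N = x) :
    minpoly F x ∣ X ^ Nat.card F ^ N - X :=
  minpoly.dvd F x (by simp [hx])

theorem minpoly_eq_iff_aeval_eq_zero {F K : Type*} [Field F] [Field K] [Algebra F K]
    {P : F[X]} (hP : P.Monic) (hPi : Irreducible P) {x : K} :
    minpoly F x = P ↔ aeval x P = 0 :=
  ⟨fun h => h ▸ minpoly.aeval F x, fun h => (minpoly.eq_of_irreducible_of_monic hPi h hP).symm⟩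

theorem pow_card_pow_eq_self_of_aeval_eq_zero {F K : Type*} [Field F] [Finite F] [Field K] [Algebra F K]
    {P : F[X]} (hPi : Irreducible P) {x : K} (hx : aeval x P = 0) : x ^ Nat.card F ^ P.natDegree = x := by
  obtain ⟨R, hR⟩ := hPi.natDegree_dvd_iff_dvd_X_pow_card_pow_sub_X.mp dvd_rfl
  have := congrArg (aeval x) hR
  rw [map_mul, hx, zero_mul] at this
  simpa [sub_eq_zero] using this

theorem mem_monicIrreducibles {F : Type*} [Field F] [Finite F] {N : ℕ} (hN : N ≠ 0) {P : F[X]} :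
    P ∈ monicIrreducibles F N ↔ P.Monic ∧ Irreducible P ∧ P.natDegree = N := by
  simp only [monicIrreducibles, Finset.mem_filter, Finset.mem_image]
  constructor
  · rintro ⟨⟨x, -, rfl⟩, h⟩
    have hx : IsIntegral F x := Algebra.IsIntegral.isIntegral x
    exact ⟨minpoly.monic hx, minpoly.irreducible hx, h⟩
  · rintro ⟨h1, h2, h3⟩
    obtain ⟨x, hx⟩ := IsAlgClosed.exists_aeval_eq_zero (AlgebraicClosure F) P
      (degree_pos_of_irreducible h2).ne'
    refine ⟨⟨x, (mem_frobeniusFixed hN).mpr ?_, (minpoly_eq_iff_aeval_eq_zero h1 h2).mpr hx⟩, h3⟩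
    rw [← h3]
    exact pow_card_pow_eq_self_of_aeval_eq_zero h2 hx

/-- Each monic irreducible polynomial of degree `N` has exactly `N` roots. -/
theorem card_filter_minpoly_mem {F : Type*} (K : Type*) [Field F] [Finite F] [Field K]
    [IsAlgClosed K] [Algebra F K] [DecidableEq F[X]] {N : ℕ} (hN : N ≠ 0) {S : Finset F[X]}
    (hS : S ⊆ monicIrreducibles F N) :
    ((frobeniusFixed F K N).filter fun x => minpoly F x ∈ S).card = N * S.card := by
  classical
  rw [Finset.card_eq_sum_card_fiberwise (f := minpoly F) (t := S)
    (fun x hx => by simpa using (Finset.mem_filter.mp hx).2), mul_comm, ← smul_eq_mul, ← Finset.sum_const]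
  refine Finset.sum_congr rfl fun P hP => ?_
  obtain ⟨h1, h2, h3⟩ := (mem_monicIrreducibles hN).mp (hS hP)
  have hcard : (P.rootSet K).toFinset.card = N := by
    rw [Set.toFinset_card, card_rootSet_eq_natDegree (PerfectField.separable_of_irreducible h2)
      (IsAlgClosed.splits _), h3]
  refine Eq.trans ?_ hcard
  congr 1
  ext x
  rw [Set.mem_toFinset, mem_rootSet_of_ne h1.ne_zero, Finset.mem_filter, Finset.mem_filter,
    mem_frobeniusFixed hN, ← minpoly_eq_iff_aeval_eq_zero h1 h2]
  constructor
  · exact fun h => h.2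
  · intro h
    refine ⟨⟨?_, h ▸ hP⟩, h⟩
    rw [← h3]
    exact pow_card_pow_eq_self_of_aeval_eq_zero h2 ((minpoly_eq_iff_aeval_eq_zero h1 h2).mp h)

theorem sum_pow_Icc_le {q : ℕ} (hq : 2 ≤ q) (m : ℕ) : ∑ d ∈ Finset.Icc 1 m, q ^ d ≤ 2 * q ^ m := by
  induction m with
  | zero => simp
  | succ m ih =>
    rw [Finset.sum_Icc_succ_top (by omega), pow_succ]
    nlinarith [Nat.zero_le (q ^ m)]

theorem le_mul_card_monicIrreducibles (F : Type*) [Field F] [Finite F] {N : ℕ} (hN : N ≠ 0) :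
    Nat.card F ^ N ≤ N * (monicIrreducibles F N).card + 2 * Nat.card F ^ (N / 2) := by
  classical
  let K := AlgebraicClosure F
  rw [← card_filter_minpoly_mem K hN subset_rfl, ← card_frobeniusFixed (F := F) (K := K) hN,
    ← Finset.card_filter_add_card_filter_not (s := frobeniusFixed F K N)
      (fun x => minpoly F x ∈ monicIrreducibles F N)]
  gcongr
  calc _ ≤ ((Finset.Icc 1 (N / 2)).biUnion (frobeniusFixed F K)).card := by
        refine Finset.card_le_card fun x hx => ?_
        rw [Finset.mem_filter, mem_frobeniusFixed hN, mem_monicIrreducibles hN] at hx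
        obtain ⟨hx1, hx2⟩ := hx
        have hint : IsIntegral F x := Algebra.IsIntegral.isIntegral x
        have hirr := minpoly.irreducible hint
        have hdvd := hirr.natDegree_dvd_of_dvd_X_pow_card_pow_sub_X (minpoly_dvd_X_pow_sub_X hx1)
        have hne : (minpoly F x).natDegree ≠ N := fun h => hx2 ⟨minpoly.monic hint, hirr, h⟩
        have hpos := hirr.natDegree_pos
        rw [Finset.mem_biUnion]
        refine ⟨(minpoly F x).natDegree, Finset.mem_Icc.mpr ⟨hpos, ?_⟩, ?_⟩
        · obtain ⟨k, hk⟩ := hdvd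
          rw [Nat.le_div_iff_mul_le two_pos, hk]
          gcongr
          by_contra! hk2
          interval_cases k <;> omega
        · rw [mem_frobeniusFixed hpos.ne']
          exact pow_card_pow_eq_self_of_aeval_eq_zero hirr (minpoly.aeval F x)
    _ ≤ ∑ d ∈ Finset.Icc 1 (N / 2), (frobeniusFixed F K d).card := Finset.card_biUnion_le
    _ ≤ ∑ d ∈ Finset.Icc 1 (N / 2), Nat.card F ^ d := by
        refine Finset.sum_le_sum fun d hd => card_frobeniusFixed_le ?_
        have := (Finset.mem_Icc.mp hd).1
        omega
    _ ≤ _ := sum_pow_Icc_le Finite.one_lt_card _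

theorem mul_card_filter_dvd_le {F : Type*} [Field F] [Finite F] {N : ℕ} (hN : N ≠ 0) {D : F[X]} (hD : D ≠ 0)
    [DecidablePred fun P : F[X] => P ∣ D] :
    N * ((monicIrreducibles F N).filter (· ∣ D)).card ≤ D.natDegree := by
  classical
  let K := AlgebraicClosure F
  rw [← card_filter_minpoly_mem K hN (Finset.filter_subset _ _)]
  refine le_trans (Finset.card_le_card (t := (D.aroots K).toFinset) fun x hx => ?_) ?_
  · rw [Finset.mem_filter, Finset.mem_filter] at hx
    obtain ⟨R, hR⟩ := hx.2.2
    rw [Multiset.mem_toFinset, mem_aroots]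
    refine ⟨hD, ?_⟩
    rw [hR, map_mul, minpoly.aeval, zero_mul]
  · refine (Multiset.toFinset_card_le _).trans ((card_roots' _).trans_eq ?_)
    rw [natDegree_map]

theorem exists_card_hasseSymbol_fiber_le {F : Type} [Field F] [Fintype F] {p e : ℕ}
    [Fact p.Prime] (he : 0 < e) (hq : Fintype.card F = p ^ e) [Algebra (ZMod p) F]
    {n n' h : RatFunc F} (hn : n = n' + (h ^ p - h))
    (hn' : derivative n'.denom ≠ 0 ∨ (n'.denom = 1 ∧ ¬ p ∣ n'.num.natDegree))
    [DecidablePred fun P : F[X] => P ∣ n.denom] :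
    ∃ C : ℕ, ∀ N : ℕ, N ≠ 0 → ∀ c : ZMod p,
      p * (N * (((monicIrreducibles F N).filter (¬ · ∣ n.denom)).filter
        (hasseSymbol p · n = c)).card) ≤
        Fintype.card F ^ N + C * p ^ ((e * N + 1) / 2) := by
  classical
  have hp : p.Prime := Fact.out
  let K := AlgebraicClosure F
  have : CharP F p := charP_of_injective_algebraMap (algebraMap (ZMod p) F).injective p
  have : CharP K p := charP_of_injective_algebraMap (algebraMap F K).injective p
  obtain ⟨C, hC⟩ := exists_artinSchreier_fiber_bound (K := K) hn hn'
  refine ⟨C + p, fun N hN c => ?_⟩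
  rw [Fintype.card_eq_nat_card] at hq ⊢
  set S := ((monicIrreducibles F N).filter (¬ · ∣ n.denom)).filter (hasseSymbol p · n = c)
    with hS
  have hSsub : S ⊆ monicIrreducibles F N :=
    (Finset.filter_subset _ _).trans (Finset.filter_subset _ _)
  have hqN : Nat.card F ^ N = p ^ (e * N) := by rw [hq, ← pow_mul]
  have heN : 0 < e * N := by positivity
  rw [← card_filter_minpoly_mem K hN hSsub]
  by_cases h1 : e * N = 1
  · have hle : ((frobeniusFixed F K N).filter fun x => minpoly F x ∈ S).card ≤ p := by
      refine (Finset.card_filter_le _ _).trans ((card_frobeniusFixed_le hN).trans_eq ?_)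
      rw [hqN, h1, pow_one]
    rw [h1, show (1 + 1) / 2 = 1 from rfl, pow_one]
    exact (Nat.mul_le_mul_left p hle).trans
      ((Nat.mul_le_mul_right p (Nat.le_add_left p C)).trans (Nat.le_add_left _ _))
  · refine (hC (e * N / 2) ((e * N + 1) / 2) N (by omega) (by omega) ?_
      (ZMod.castHom (dvd_refl p) K c) _ fun x hx => ?_).trans (by gcongr; omega)
    · rw [hqN]
      congr 1
      omega
    · rw [Finset.mem_filter, mem_frobeniusFixed hN, hS, Finset.mem_filter, Finset.mem_filter,
        mem_monicIrreducibles hN] at hx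
      obtain ⟨hx, ⟨⟨hmon, hirr, hdeg⟩, hdvd⟩, hc⟩ := hx
      have hden : aeval x n.denom ≠ 0 := fun h0 => hdvd (minpoly.dvd F x h0)
      refine ⟨hx, hden, ?_⟩
      obtain ⟨y, hy⟩ := IsAlgClosed.exists_aeval_eq_zero K
        (X ^ p - (X + Polynomial.C (aeval x n.num / aeval x n.denom)) : K[X]) (by
          have hlt : (X + Polynomial.C (aeval x n.num / aeval x n.denom) : K[X]).degree < p := by
            rw [degree_X_add_C]; exact_mod_cast hp.one_lt
          rw [degree_sub_eq_left_of_degree_lt (by rwa [degree_X_pow]), degree_X_pow]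
          exact_mod_cast hp.ne_zero)
      have hy' : aeval x n.denom * (y ^ p - y) = aeval x n.num := by
        simp only [map_sub, map_add, map_pow, aeval_X, aeval_C, Algebra.algebraMap_self,
          RingHom.id_apply] at hy
        rw [← sub_sub, sub_eq_zero] at hy
        rw [hy, mul_div_cancel₀ _ hden]
      refine ⟨y, hy', ?_⟩
      have := pow_card_pow_eq_add_hasseSymbol hirr hdvd (minpoly.aeval F x) hy'
      rwa [hdeg, hc] at this

theorem sum_pow_hasseChar {p : ℕ} (hp : p.Prime) {F : Type} [Field F] [Fintype F]
    [Algebra (ZMod p) F] (P : F[X]) (n : RatFunc F) :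
    ∑ j ∈ Finset.Icc 1 (p - 1), hasseChar p P n ^ j =
      p * (if hasseSymbol p P n = 0 then 1 else 0) - 1 := by
  have : NeZero p := ⟨hp.ne_zero⟩
  have hp0 : (p : ℂ) ≠ 0 := by exact_mod_cast hp.ne_zero
  have hsum : ∑ j ∈ Finset.Icc 1 (p - 1), hasseChar p P n ^ j =
      ∑ j ∈ Finset.range p, hasseChar p P n ^ j - 1 := by
    obtain ⟨r, rfl⟩ : ∃ r, p = r + 1 := Nat.exists_eq_add_of_le' hp.one_le
    rw [Finset.sum_range_succ', pow_zero, add_sub_cancel_right, Nat.add_sub_cancel,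
      Finset.range_eq_Ico, Finset.sum_Ico_add' (fun j => hasseChar (r + 1) P n ^ j)]
    rfl
  rw [hsum]
  congr 1
  split_ifs with h
  · simp [hasseChar, h]
  · have hone : hasseChar p P n ≠ 1 := by
      rw [hasseChar, Ne, Complex.exp_eq_one_iff]
      rintro ⟨m, hm⟩
      have h2 : (2 * Real.pi * Complex.I : ℂ) ≠ 0 := Complex.two_pi_I_ne_zero
      rw [mul_div_assoc, mul_comm (m : ℂ), mul_right_inj' h2, div_eq_iff hp0] at hm
      have hm' : ((hasseSymbol p P n).val : ℤ) = m * p := by exact_mod_cast hm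
      have hdvd : (p : ℤ) ∣ (hasseSymbol p P n).val := ⟨m, by rw [hm', mul_comm]⟩
      rw [Int.natCast_dvd_natCast] at hdvd
      exact h ((ZMod.val_eq_zero _).mp (Nat.eq_zero_of_dvd_of_lt hdvd (ZMod.val_lt _)))
    have hpow : hasseChar p P n ^ p = 1 := by
      rw [hasseChar, ← Complex.exp_nat_mul, Complex.exp_eq_one_iff]
      refine ⟨(hasseSymbol p P n).val, ?_⟩
      push_cast
      field_simp
    rw [geom_sum_eq hone, hpow]
    simp

theorem artinSchreier_sum_eq {p : ℕ} (hp : p.Prime) {F : Type} [Field F] [Fintype F]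
    [Algebra (ZMod p) F] (n : RatFunc F) {N : ℕ} (hN : N ≠ 0)
    [DecidablePred fun P : F[X] => P ∣ n.denom] :
    ∑ᶠ P ∈ {P : F[X] | P.Monic ∧ Irreducible P ∧ P.natDegree = N ∧ ¬ P ∣ n.denom},
      ∑ j ∈ Finset.Icc 1 (p - 1), hasseChar p P n ^ j =
    p * ((((monicIrreducibles F N).filter (¬ · ∣ n.denom)).filter
      (hasseSymbol p · n = 0)).card : ℂ) -
      ((monicIrreducibles F N).filter (¬ · ∣ n.denom)).card := by
  have hset : {P : F[X] | P.Monic ∧ Irreducible P ∧ P.natDegree = N ∧ ¬ P ∣ n.denom} =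
      ((monicIrreducibles F N).filter (¬ · ∣ n.denom) : Finset F[X]) := by
    ext P
    simp [mem_monicIrreducibles hN, and_assoc]
  rw [hset, finsum_mem_coe_finset, Finset.sum_congr rfl fun P _ => sum_pow_hasseChar hp P n,
    Finset.sum_sub_distrib, ← Finset.mul_sum, Finset.sum_boole]
  simp

theorem exists_card_hasseSymbol_zero_bound {F : Type} [Field F] [Fintype F] {p e : ℕ}
    [Fact p.Prime] (he : 0 < e) (hq : Fintype.card F = p ^ e) [Algebra (ZMod p) F]
    {n n' h : RatFunc F} (hn : n = n' + (h ^ p - h))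
    (hn' : derivative n'.denom ≠ 0 ∨ (n'.denom = 1 ∧ ¬ p ∣ n'.num.natDegree))
    [DecidablePred fun P : F[X] => P ∣ n.denom] :
    ∃ C : ℝ, ∀ N : ℕ, N ≠ 0 →
      |p * ((((monicIrreducibles F N).filter (¬ · ∣ n.denom)).filter
        (hasseSymbol p · n = 0)).card : ℝ) -
        ((monicIrreducibles F N).filter (¬ · ∣ n.denom)).card| * N ≤
        C * (Fintype.card F : ℝ) ^ ((N : ℝ) / 2) := by
  classical
  have hp : p.Prime := Fact.out
  have : NeZero p := ⟨hp.ne_zero⟩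
  obtain ⟨C, hC⟩ := exists_card_hasseSymbol_fiber_le he hq hn hn'
  refine ⟨p * (C * p + 2 + n.denom.natDegree), fun N hN => ?_⟩
  set G := (monicIrreducibles F N).filter (¬ · ∣ n.denom) with hG
  set T : ZMod p → ℕ := fun c => (G.filter (hasseSymbol p · n = c)).card with hT
  set s : ℝ := (Fintype.card F : ℝ) ^ ((N : ℝ) / 2) with hs
  set Q : ℝ := (Fintype.card F : ℝ) ^ N with hQ
  have hq1 : (1 : ℝ) ≤ Fintype.card F := by exact_mod_cast Fintype.card_pos
  have hs1 : 1 ≤ s := Real.one_le_rpow hq1 (by positivity)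
  have hp1 : (1 : ℝ) ≤ p := by exact_mod_cast hp.one_le
  have hfloor : (Fintype.card F : ℝ) ^ (N / 2) ≤ s := by
    rw [← Real.rpow_natCast]
    exact Real.rpow_le_rpow_of_exponent_le hq1 Nat.cast_div_le
  have hceil : (p : ℝ) ^ ((e * N + 1) / 2) ≤ p * s := by
    have hps : (p : ℝ) * s = (p : ℝ) ^ (1 + (e * N : ℝ) / 2) := by
      rw [Real.rpow_add (by positivity), Real.rpow_one, hs, hq, Nat.cast_pow,
        ← Real.rpow_natCast, ← Real.rpow_mul (by positivity), mul_div_assoc]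
    rw [hps, ← Real.rpow_natCast]
    refine Real.rpow_le_rpow_of_exponent_le hp1 (Nat.cast_div_le.trans ?_)
    push_cast
    linarith
  have hupper (c : ZMod p) : p * (N * (T c : ℝ)) ≤ Q + C * (p * s) := by
    have h1 : (p * (N * (T c : ℝ)) : ℝ) ≤ Q + C * (p : ℝ) ^ ((e * N + 1) / 2) := by
      rw [hQ]
      exact_mod_cast hC N hN c
    exact h1.trans (by gcongr)
  have hsum : (G.card : ℝ) = ∑ c, (T c : ℝ) := by
    exact_mod_cast Finset.card_eq_sum_card_fiberwise (f := fun P => hasseSymbol p P n)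
      (t := Finset.univ) fun _ _ => by simp
  have hGcard : N * (G.card : ℝ) ≤ Q := by
    have h1 := card_filter_minpoly_mem (AlgebraicClosure F) hN (S := G) (Finset.filter_subset _ _)
    have h2 := (Finset.card_filter_le _ fun x => minpoly F x ∈ G).trans
      (card_frobeniusFixed_le (F := F) (K := AlgebraicClosure F) hN)
    rw [h1, ← Fintype.card_eq_nat_card (α := F)] at h2
    rw [hQ]
    exact_mod_cast h2
  have hGlower : Q ≤ N * (G.card : ℝ) + n.denom.natDegree + 2 * s := by
    have h1 := le_mul_card_monicIrreducibles F hN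
    have h2 := mul_card_filter_dvd_le hN n.denom_ne_zero
    have h3 : ((monicIrreducibles F N).filter (· ∣ n.denom)).card + G.card =
        (monicIrreducibles F N).card := Finset.card_filter_add_card_filter_not _
    rw [← h3, mul_add, ← Fintype.card_eq_nat_card] at h1
    have h4 : Fintype.card F ^ N ≤
        N * G.card + n.denom.natDegree + 2 * Fintype.card F ^ (N / 2) := by
      omega
    have h5 : Q ≤ N * (G.card : ℝ) + n.denom.natDegree + 2 * (Fintype.card F : ℝ) ^ (N / 2) := by
      rw [hQ]
      exact_mod_cast h4
    linarith
  have hrest : p * (N * ∑ c ∈ Finset.univ.erase (0 : ZMod p), (T c : ℝ)) ≤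
      (p - 1) * (Q + C * (p * s)) := by
    rw [Finset.mul_sum, Finset.mul_sum]
    refine (Finset.sum_le_card_nsmul _ _ _ fun c _ => hupper c).trans_eq ?_
    rw [Finset.card_erase_of_mem (Finset.mem_univ _), Finset.card_univ, ZMod.card, nsmul_eq_mul,
      Nat.cast_pred hp.pos]
  rw [← Finset.add_sum_erase _ _ (Finset.mem_univ (0 : ZMod p))] at hsum
  have hd : (0 : ℝ) ≤ n.denom.natDegree := Nat.cast_nonneg _
  have hds : (n.denom.natDegree : ℝ) ≤ n.denom.natDegree * s := le_mul_of_one_le_right hd hs1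
  have hN0 : (0 : ℝ) ≤ N := Nat.cast_nonneg _
  set W : ℝ := C * (p * s) + 2 * s + n.denom.natDegree * s with hW
  have hCp : (0 : ℝ) ≤ C * (p * s) := by positivity
  have hWp : W ≤ p * W := le_mul_of_one_le_left (by positivity) hp1
  rw [show p * (C * p + 2 + n.denom.natDegree) * s = p * W by rw [hW]; ring]
  change |p * (T 0 : ℝ) - G.card| * N ≤ _
  rw [← abs_of_nonneg hN0, ← abs_mul, abs_le]
  constructor
  · have h1 : (p * (N * (G.card : ℝ)) : ℝ) ≤ p * (N * T 0) + (p - 1) * (Q + C * (p * s)) := by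
      rw [hsum]
      linarith
    have h2 : (p - 1) * (Q - N * (G.card : ℝ) + C * (p * s)) ≤ (p - 1) * W :=
      mul_le_mul_of_nonneg_left (by linarith) (by linarith)
    nlinarith
  · linarith [hupper 0]

theorem natCard_monic_irreducible {F : Type*} [Field F] [Finite F] {N : ℕ} (hN : N ≠ 0) :
    Nat.card {P : F[X] // P.Monic ∧ Irreducible P ∧ P.natDegree = N} =
      (monicIrreducibles F N).card := by
  rw [← Nat.card_eq_finsetCard]
  exact Nat.card_congr (Equiv.subtypeEquivRight fun P => (mem_monicIrreducibles hN).symm)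

/-- **Character sum estimate for a geometric Artin–Schreier extension (Lemma 3.2).**
Let `q` be a power of a prime `p`, `k = F_q(t)`, and `n ∈ k` nonzero such that
`E = k(α)` with `α^p − α = n` is a geometric Artin–Schreier extension of `k` of degree `p`.
Then the sum over monic irreducible `P` of degree `N` (with `ord_P(n) ≥ 0`) of
`{{n/P}} + {{n/P}}^2 + ⋯ + {{n/P}}^{p−1}` is `o(π(N))` as `N → ∞`; more precisely it is
`O(q^{N/2}/N)`. -/
theorem artinSchreier_char_sum_o_pi
    (p e : ℕ) (hp : p.Prime) (he : 0 < e)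
    (Fq : Type) [Field Fq] [Fintype Fq] (hq : Fintype.card Fq = p ^ e)
    [Algebra (ZMod p) Fq]
    (n : RatFunc Fq) (hn : n ≠ 0)
    -- `E = k(α)` with `α^p − α = n`, a geometric extension of `k` of degree `p`
    (E : Type) [Field E] [Algebra (RatFunc Fq) E] [Algebra Fq E]
    [IsScalarTower Fq (RatFunc Fq) E]
    (α : E)
    (hα : α ^ p - α = algebraMap (RatFunc Fq) E n)
    (hgen : Algebra.adjoin (RatFunc Fq) ({α} : Set E) = ⊤)
    (hdeg : Module.finrank (RatFunc Fq) E = p)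
    (hgeo : ∀ x : E, IsAlgebraic Fq x → ∃ c : Fq, algebraMap Fq E c = x) :
    -- the sum is o(π(N)) ...
    Tendsto (fun N : ℕ =>
        ‖∑ᶠ P ∈ {P : Polynomial Fq |
              P.Monic ∧ Irreducible P ∧ P.natDegree = N ∧ ¬ P ∣ n.denom},
            ∑ j ∈ Finset.Icc 1 (p - 1), hasseChar p P n ^ j‖ /
          (Nat.card {P : Polynomial Fq // P.Monic ∧ Irreducible P ∧ P.natDegree = N} : ℝ))
      atTop (nhds 0) ∧
    -- ... more precisely, it is O(q^{N/2}/N)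
    ∃ C : ℝ, ∀ N : ℕ, 1 ≤ N →
      ‖∑ᶠ P ∈ {P : Polynomial Fq |
            P.Monic ∧ Irreducible P ∧ P.natDegree = N ∧ ¬ P ∣ n.denom},
          ∑ j ∈ Finset.Icc 1 (p - 1), hasseChar p P n ^ j‖ ≤
        C * (Fintype.card Fq : ℝ) ^ ((N : ℝ) / 2) / N := by
  classical
  have : Fact p.Prime := ⟨hp⟩
  have : CharP Fq p := charP_of_injective_algebraMap (algebraMap (ZMod p) Fq).injective p
  obtain ⟨h, n', hn1, hn2⟩ := RatFunc.exists_artinSchreier_reduced_of_geometric hα hgen hdeg hgeo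
  obtain ⟨C, hC⟩ := exists_card_hasseSymbol_zero_bound he hq hn1 hn2
  set S : ℕ → ℝ := fun N => ‖∑ᶠ P ∈ {P : Polynomial Fq |
    P.Monic ∧ Irreducible P ∧ P.natDegree = N ∧ ¬ P ∣ n.denom},
      ∑ j ∈ Finset.Icc 1 (p - 1), hasseChar p P n ^ j‖ with hS
  set s : ℕ → ℝ := fun N => (Fintype.card Fq : ℝ) ^ ((N : ℝ) / 2) with hs
  have hbound : ∀ N : ℕ, N ≠ 0 → S N * N ≤ C * s N := by
    intro N hN
    refine le_trans (le_of_eq ?_) (hC N hN)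
    simp only [hS]
    rw [artinSchreier_sum_eq hp n hN, ← Real.norm_eq_abs, ← Complex.norm_real]
    push_cast
    rfl
  refine ⟨?_, C, fun N hN => ?_⟩
  · have hq1 : (1 : ℝ) < Fintype.card Fq := by exact_mod_cast Fintype.one_lt_card
    have hs_top : Tendsto s atTop atTop :=
      (tendsto_rpow_atTop_of_base_gt_one _ hq1).comp
        (tendsto_natCast_atTop_atTop.atTop_div_const two_pos)
    have hlim : Tendsto (fun N => C / (s N - 2)) atTop (nhds 0) :=
      tendsto_const_nhds.div_atTop (tendsto_atTop_add_const_right _ _ hs_top)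
    refine squeeze_zero' (Eventually.of_forall fun N => by positivity) ?_ hlim
    filter_upwards [hs_top.eventually_gt_atTop 2, eventually_ne_atTop 0] with N hs2 hN
    rw [natCard_monic_irreducible hN]
    change S N / _ ≤ _
    have hN0 : (0 : ℝ) < N := by positivity
    have hπ : s N * (s N - 2) ≤ N * ((monicIrreducibles Fq N).card : ℝ) := by
      have h1 : (Fintype.card Fq : ℝ) ^ N ≤
          N * ((monicIrreducibles Fq N).card : ℝ) + 2 * (Fintype.card Fq : ℝ) ^ (N / 2) := by
        rw [Fintype.card_eq_nat_card]
        exact_mod_cast le_mul_card_monicIrreducibles Fq hN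
      have h2 : (Fintype.card Fq : ℝ) ^ (N / 2) ≤ s N := by
        rw [← Real.rpow_natCast]
        exact Real.rpow_le_rpow_of_exponent_le hq1.le Nat.cast_div_le
      have h3 : s N * s N = (Fintype.card Fq : ℝ) ^ N := by
        simp only [hs]
        rw [← Real.rpow_add (by positivity), add_halves, Real.rpow_natCast]
      linarith
    have hpos : 0 < s N * (s N - 2) := mul_pos (by linarith) (by linarith)
    have hS0 : 0 ≤ S N := norm_nonneg _
    have hb := hbound N hN
    have hCs : 0 ≤ C * s N := le_trans (by positivity) hb
    calc S N / ((monicIrreducibles Fq N).card : ℝ)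
        = S N * N / (N * ((monicIrreducibles Fq N).card : ℝ)) := by
          rw [mul_comm (S N), mul_div_mul_left _ _ hN0.ne']
      _ ≤ C * s N / (s N * (s N - 2)) := by gcongr
      _ = C / (s N - 2) := by
          rw [mul_comm C, mul_div_mul_left _ _ (by linarith)]
  · have hN0 : (0 : ℝ) < N := by exact_mod_cast hN
    rw [le_div_iff₀ hN0]
    exact hbound N (by omega)
end
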